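/- arXiv:2401.00358 — 2 statements merged into one kernel-verified Lean document; each statement's English description precedes it below -/
import Mathlib

section
/- Let F, G ∈ ℤ[T] be multiplicatively independent polynomials with F nonconstant and not squarefull in ℤ[T]. There exist constants κ_0(F) and κ_1(F, G) such that: (a) for every integer N ≥ 2, every prime ℓ > κ_0(F) and every w ∈ 𝔽_ℓ^×, the polynomial ∏_{i=1}^N F(X_i) − w is irreducible in the polynomial ring 𝔽̄_ℓ[X_1,…,X_N] over an algebraic closure 𝔽̄_ℓ of 𝔽_ℓ; and (b) for every prime ℓ > κ_1(F, G) and all u, w ∈ 𝔽_ℓ^×, the polynomial F(X)F(Y)F(Z) − u is irreducible in 𝔽̄_ℓ[X, Y, Z] and does not divide the polynomial G(X)G(Y)G(Z) − w in 𝔽̄_ℓ[X, Y, Z]. -/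
open Polynomial
open scoped Classical

noncomputable section

/-- `f : ℕ → ℤ` is a multiplicative arithmetic function. -/
def IsMultFn (f : ℕ → ℤ) : Prop :=
  f 1 = 1 ∧ ∀ m n : ℕ, Nat.Coprime m n → f (m * n) = f m * f n

/-- The polynomials `F i` are multiplicatively independent over `ℤ`:
no nonzero integer tuple `c` makes `∏ i, (F i) ^ (c i)` identically constant in `ℚ(T)`. -/
def MultIndep {m : ℕ} (F : Fin m → Polynomial ℤ) : Prop :=
  ¬ ∃ c : Fin m → ℤ, c ≠ 0 ∧ ∃ r : ℚ,
      (∏ i, (algebraMap (Polynomial ℚ) (RatFunc ℚ) ((F i).map (Int.castRingHom ℚ))) ^ (c i))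
        = algebraMap ℚ (RatFunc ℚ) r

/-- `β` is the last invariant factor of the exponent matrix of the family `F`
(for some factorization of the `F i` into pairwise non-associated primitive irreducibles,
via a Smith normal form of the exponent matrix). -/
def IsLastInvFactor {m : ℕ} (F : Fin m → Polynomial ℤ) (β : ℤ) : Prop :=
  ∃ (M : ℕ) (G : Fin M → Polynomial ℤ) (c : Fin m → ℤ) (μ : Fin M → Fin m → ℕ),
    (∀ j, Irreducible (G j)) ∧
    (∀ j, (G j).IsPrimitive) ∧
    (∀ j j', j ≠ j' → ¬ Associated (G j) (G j')) ∧
    (∀ i, F i = Polynomial.C (c i) * ∏ j, G j ^ μ j i) ∧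
    (∀ j, ∃ i, 0 < μ j i) ∧
    ∃ (P : Matrix (Fin M) (Fin M) ℤ) (Q : Matrix (Fin m) (Fin m) ℤ),
      IsUnit P.det ∧ IsUnit Q.det ∧
      (∀ (s : Fin M) (t : Fin m), (s : ℕ) ≠ (t : ℕ) →
        (P * (Matrix.of fun u v => (μ u v : ℤ)) * Q) s t = 0) ∧
      (∀ (s s' : Fin M) (t t' : Fin m), (s : ℕ) = (t : ℕ) → (s' : ℕ) = (t' : ℕ) →
        (s : ℕ) + 1 = (s' : ℕ) →
        (P * (Matrix.of fun u v => (μ u v : ℤ)) * Q) s t ∣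
          (P * (Matrix.of fun u v => (μ u v : ℤ)) * Q) s' t') ∧
      (∀ (s : Fin M) (t : Fin m), (s : ℕ) = (t : ℕ) → (s : ℕ) + 1 = min M m →
        β = (P * (Matrix.of fun u v => (μ u v : ℤ)) * Q) s t)

/-- Invariant Factor Hypothesis `IFH(F; B₀)` for the modulus `q`. -/
def IFH {m : ℕ} (F : Fin m → Polynomial ℤ) (B₀ : ℝ) (q : ℕ) : Prop :=
  ∀ β : ℤ, IsLastInvFactor F β →
    ∀ ℓ : ℕ, ℓ.Prime → ℓ ∣ q → B₀ < (ℓ : ℝ) → Int.gcd ((ℓ : ℤ) - 1) β = 1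

/-- `alphaRatio q P`: the proportion of units `u` mod `q` with `P(u)` a unit mod `q`. -/
def alphaRatio (q : ℕ) (P : Polynomial ℤ) : ℝ :=
  (Nat.card {u : (ZMod q)ˣ // IsUnit (Polynomial.aeval ((u : ZMod q)) P)} : ℝ)
    / (Nat.totient q : ℝ)

/-- `q` is `k`-admissible with respect to the family of products `Wprod v`. -/
def KAdmissible (Wprod : ℕ → Polynomial ℤ) (k q : ℕ) : Prop :=
  (∃ u : (ZMod q)ˣ, IsUnit (Polynomial.aeval ((u : ZMod q)) (Wprod k))) ∧
  ∀ v, 1 ≤ v → v < k → ¬ ∃ u : (ZMod q)ˣ, IsUnit (Polynomial.aeval ((u : ZMod q)) (Wprod v))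

/-- Narkiewicz's set `Q(k; f_1, …, f_K)`. -/
def NarkSet {K : ℕ} (k : ℕ) (f : Fin K → ℕ → ℤ) (W : Fin K → ℕ → Polynomial ℤ) : Set ℕ :=
  {q | KAdmissible (fun v => ∏ i, W i v) k q ∧
    ∀ χ : Fin K → DirichletCharacter ℂ q, χ ≠ (fun _ => 1) →
      (∀ u : (ZMod q)ˣ, IsUnit (Polynomial.aeval ((u : ZMod q)) (∏ i, W i k)) →
          (∏ i, (χ i) (Polynomial.aeval ((u : ZMod q)) (W i k))) = 1) →
      ∃ p : ℕ, p.Prime ∧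
        (∑' j : ℕ, (∏ i, (χ i) ((f i (p ^ j) : ZMod q))) *
            ((((p : ℝ) ^ (-(j : ℝ) / (k : ℝ))) : ℝ) : ℂ)) = 0}

/-- `Pj j n`: the `j`-th largest prime factor of `n` counted with multiplicity,
equal to `1` if `Ω(n) < j`. -/
def Pj (j n : ℕ) : ℕ := (n.primeFactorsList.reverse).getD (j - 1) 1

/-- `nPart k n` is `n_k`, the largest positive integer whose `k`-th power is a
unitary divisor of `n`. -/
def nPart (k n : ℕ) : ℕ :=
  ∏ p ∈ n.primeFactors, if k ∣ n.factorization p then p ^ (n.factorization p / k) else 1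

/-- A polynomial is squarefull in `ℤ[T]` iff every complex root has multiplicity at least 2. -/
def SquarefullPoly (F : Polynomial ℤ) : Prop :=
  ∀ z : ℂ, (F.map (Int.castRingHom ℂ)).IsRoot z →
    2 ≤ (F.map (Int.castRingHom ℂ)).rootMultiplicity z

/-- `n` is convenient (with respect to exponent `k`, threshold `y` and length `J`). -/
def Convenient (k : ℕ) (y : ℝ) (J : ℕ) (n : ℕ) : Prop :=
  ∃ (m : ℕ) (P : Fin J → ℕ), 0 < m ∧ (∀ t, (P t).Prime) ∧
    (∀ s t : Fin J, s < t → P t < P s) ∧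
    (∀ t, y < (P t : ℝ) ∧ Pj 1 m < P t) ∧
    n = m * (∏ t, P t) ^ k

/-- The solution count `Ṽ_{N,K}(q; (w_i))`. -/
def VNK {K N : ℕ} (F : Fin K → Fin N → Polynomial ℤ) (q : ℕ) (w : Fin K → ZMod q) : ℕ :=
  Nat.card {v : Fin N → (ZMod q)ˣ //
    ∀ i, (∏ j, Polynomial.aeval ((v j : ZMod q)) (F i j)) = w i}

/-- `α*_N(q) = ∏_j α̃_j(q)`. -/
def alphaStarN {K N : ℕ} (F : Fin K → Fin N → Polynomial ℤ) (q : ℕ) : ℝ :=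
  ∏ j, alphaRatio q (∏ i, F i j)

/-- `n` is `r`-full: every prime dividing `n` divides it to the `r`-th power. -/
def IsRFull (r n : ℕ) : Prop := ∀ p : ℕ, p.Prime → p ∣ n → p ^ r ∣ n

/-- The `k`-free part of `n`. -/
def kfreePart (k n : ℕ) : ℕ :=
  ∏ p ∈ n.primeFactors, if n.factorization p < k then p ^ n.factorization p else 1

lemma Polynomial.irreducible_of_irreducible_reverse {R : Type*} [CommRing R] [IsDomain R]
    {p : R[X]} (h0 : p.coeff 0 ≠ 0) (hp : Irreducible p.reverse) : Irreducible p := by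
  have isUnit_of_reverse {a : R[X]} (ha0 : a.coeff 0 ≠ 0) (ha : IsUnit a.reverse) :
      IsUnit a := by
    have hdeg : a.natDegree = 0 := by
      rw [natDegree_eq_reverse_natDegree_add_natTrailingDegree, natDegree_eq_zero_of_isUnit ha,
        natTrailingDegree_eq_zero_of_constantCoeff_ne_zero ha0]
    obtain ⟨r, rfl⟩ := natDegree_eq_zero.1 hdeg
    rwa [reverse_C] at ha
  refine ⟨fun h => hp.not_isUnit ?_, fun a b hab => ?_⟩
  · obtain ⟨r, hr, rfl⟩ := Polynomial.isUnit_iff.1 h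
    rwa [reverse_C]
  · rw [hab, mul_coeff_zero] at h0
    rw [hab, reverse_mul_of_domain] at hp
    exact (hp.isUnit_or_isUnit rfl).imp (isUnit_of_reverse (left_ne_zero_of_mul h0))
      (isUnit_of_reverse (right_ne_zero_of_mul h0))

lemma Polynomial.irreducible_C_mul_sub_C {R : Type*} [CommRing R] [IsDomain R] {p c w : R}
    (hp : Prime p) (hpc : p ∣ c) (hpc2 : ¬ p ^ 2 ∣ c) (hw : IsUnit w) {f : R[X]}
    (hf : 0 < f.natDegree) (hlc : IsUnit f.leadingCoeff) : Irreducible (C c * f - C w) := by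
  have hc : c ≠ 0 := fun h => hpc2 (h ▸ dvd_zero _)
  have hdeg : (C c * f - C w).natDegree = f.natDegree := by
    rw [natDegree_sub_C, natDegree_C_mul hc]
  have hlead : (C c * f - C w).leadingCoeff = c * f.leadingCoeff := by
    rw [leadingCoeff, hdeg, coeff_sub, coeff_C_mul, coeff_C_of_ne_zero hf.ne', sub_zero]
    rfl
  have hzero : (C c * f - C w).coeff 0 = c * f.coeff 0 - w := by simp
  have hpzero : ¬ p ∣ (C c * f - C w).coeff 0 := fun h =>
    hp.not_isUnit (isUnit_of_dvd_unit
      ((dvd_sub_right (hpc.mul_right _)).1 (hzero ▸ h)) hw)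
  have hzero' : (C c * f - C w).coeff 0 ≠ 0 := fun h => hpzero (h ▸ dvd_zero _)
  have hpos : ∀ n, n ≠ 0 → (C c * f - C w).coeff n = c * f.coeff n := fun n hn => by
    simp [coeff_C_of_ne_zero hn]
  generalize C c * f - C w = P at *
  have hrdeg : P.reverse.natDegree = f.natDegree := by
    rw [reverse_natDegree, natTrailingDegree_eq_zero_of_constantCoeff_ne_zero hzero', hdeg,
      Nat.sub_zero]
  have hrcoeff : ∀ n ≤ f.natDegree, P.reverse.coeff n = P.coeff (f.natDegree - n) :=
    fun n hn => by rw [coeff_reverse, hdeg, revAt_le hn]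
  refine irreducible_of_irreducible_reverse hzero' ?_
  refine irreducible_of_eisenstein_criterion (P := Ideal.span {p})
    ((Ideal.span_singleton_prime hp.ne_zero).2 hp) ?_ ?_ ?_ ?_ ?_
  · rw [Ideal.mem_span_singleton, leadingCoeff, hrdeg, hrcoeff _ le_rfl, Nat.sub_self]
    exact hpzero
  · intro n hn
    have hn' : n < f.natDegree := by
      rw [← hrdeg]; exact coe_lt_degree.1 hn
    rw [Ideal.mem_span_singleton, hrcoeff n hn'.le, hpos _ (Nat.sub_ne_zero_of_lt hn')]
    exact hpc.mul_right _
  · rw [← natDegree_pos_iff_degree_pos, hrdeg]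
    exact hf
  · rw [coeff_zero_reverse, hlead, Ideal.span_singleton_pow, Ideal.mem_span_singleton]
    exact fun h => hpc2 ((hlc.dvd_mul_right).1 h)
  · intro r hr
    rw [C_dvd_iff_dvd_coeff] at hr
    have h1 : r ∣ c := by
      have := hr 0
      rw [coeff_zero_reverse, hlead] at this
      exact (hlc.dvd_mul_right).1 this
    have h2 := hr f.natDegree
    rw [hrcoeff _ le_rfl, Nat.sub_self, hzero] at h2
    exact isUnit_of_dvd_unit ((dvd_sub_right (h1.mul_right _)).1 h2) hw

lemma irreducible_prod_aeval_sub_C {K : Type*} [Field K] {f : K[X]} {α : K}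
    (hα : f.IsRoot α) (hα' : ¬ f.derivative.IsRoot α) {w : K} (hw : w ≠ 0) {N : ℕ}
    (hN : 2 ≤ N) :
    Irreducible ((∏ i : Fin N, (aeval (MvPolynomial.X i) f : MvPolynomial (Fin N) K)) -
      MvPolynomial.C w) := by
  obtain ⟨n, rfl⟩ := Nat.exists_eq_add_of_le' hN
  have hf : f ≠ 0 := by rintro rfl; simp at hα'
  have hdeg : 0 < f.natDegree := by
    refine Nat.pos_of_ne_zero fun h => hα' ?_
    rw [derivative_of_natDegree_zero h]
    simp
  have finSucc_C (m : ℕ) (a : K) :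
      MvPolynomial.finSuccEquiv K m (MvPolynomial.C a) = C (MvPolynomial.C a) := by
    simp [MvPolynomial.finSuccEquiv_apply]
  have finSucc_zero (m : ℕ) : MvPolynomial.finSuccEquiv K m (aeval (MvPolynomial.X 0) f) =
      f.map MvPolynomial.C := by
    rw [← AlgEquiv.coe_toAlgHom, ← aeval_algHom_apply, AlgEquiv.coe_toAlgHom,
      MvPolynomial.finSuccEquiv_X_zero, ← MvPolynomial.algebraMap_eq,
      ← aeval_map_algebraMap (MvPolynomial (Fin m) K), aeval_X_left_apply]
  have finSucc_succ (m : ℕ) (i : Fin m) :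
      MvPolynomial.finSuccEquiv K m (aeval (MvPolynomial.X i.succ) f) =
        C (aeval (MvPolynomial.X i) f) := by
    rw [← AlgEquiv.coe_toAlgHom, ← aeval_algHom_apply, AlgEquiv.coe_toAlgHom,
      MvPolynomial.finSuccEquiv_X_succ]
    exact aeval_algHom_apply (CAlgHom : _ →ₐ[K] (MvPolynomial (Fin m) K)[X]) _ _
  have aeval_ne_zero (m : ℕ) (i : Fin m) :
      aeval (MvPolynomial.X i : MvPolynomial (Fin m) K) f ≠ 0 := by
    intro h
    apply hf
    have := congrArg (MvPolynomial.aeval (fun _ => (X : K[X]))) h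
    rwa [← aeval_algHom_apply, MvPolynomial.aeval_X, aeval_X_left_apply, map_zero] at this
  set p : MvPolynomial (Fin (n + 1)) K := MvPolynomial.X 0 - MvPolynomial.C α with hp_def
  have hp : MvPolynomial.finSuccEquiv K n p = X - C (MvPolynomial.C α) := by
    rw [hp_def, map_sub, MvPolynomial.finSuccEquiv_X_zero, finSucc_C]
  have hc : MvPolynomial.finSuccEquiv K n (∏ i, aeval (MvPolynomial.X i) f) =
      f.map MvPolynomial.C * C (∏ i, aeval (MvPolynomial.X i) f) := by
    rw [Fin.prod_univ_succ, map_mul, finSucc_zero, map_prod, map_prod]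
    simp_rw [finSucc_succ]
  have hroot : (f.map (MvPolynomial.C : K →+* MvPolynomial (Fin n) K)).IsRoot
      (MvPolynomial.C α) := by
    rw [IsRoot, eval_map_apply, hα.eq_zero, map_zero]
  rw [← MulEquiv.irreducible_iff (MvPolynomial.finSuccEquiv K (n + 1)), map_sub, finSucc_C,
    Fin.prod_univ_succ, map_mul, finSucc_zero, map_prod]
  simp_rw [finSucc_succ]
  rw [← map_prod, mul_comm]
  refine irreducible_C_mul_sub_C (p := p) ?_ ?_ ?_ ?_ ?_ ?_
  · rw [← MulEquiv.prime_iff (MvPolynomial.finSuccEquiv K n), hp]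
    exact prime_X_sub_C _
  · rw [← map_dvd_iff (MvPolynomial.finSuccEquiv K n), hp, hc]
    exact (dvd_iff_isRoot.2 hroot).mul_right _
  · rw [← map_dvd_iff (MvPolynomial.finSuccEquiv K n), map_pow, hp, hc]
    rintro ⟨q, hq⟩
    have := congrArg (fun g => (derivative g).eval (MvPolynomial.C α)) hq
    simp only [derivative_mul, derivative_C, mul_zero, add_zero, eval_mul, eval_C, derivative_map,
      eval_map_apply, derivative_X_sub_C_sq, eval_add, eval_sub, eval_pow, eval_X, sub_self,
      zero_mul, ne_eq, OfNat.ofNat_ne_zero, not_false_eq_true, zero_pow] at this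
    refine mul_ne_zero ?_ ?_ this
    · simpa using hα'
    · exact Finset.prod_ne_zero_iff.2 fun i _ => aeval_ne_zero n i
  · exact (isUnit_iff_ne_zero.2 hw).map _
  · rwa [natDegree_map_eq_of_injective (MvPolynomial.C_injective _ _)]
  · rw [leadingCoeff_map_of_injective (MvPolynomial.C_injective _ _)]
    exact (isUnit_iff_ne_zero.2 (leadingCoeff_ne_zero.2 hf)).map _

lemma exists_bezout_of_simple_root {F : ℤ[X]} {z : ℂ} (hz : aeval z F = 0)
    (hz' : aeval z (derivative F) ≠ 0) (hF : F ≠ 0) :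
    ∃ (H A B Q : ℤ[X]) (D e : ℤ), 0 < H.natDegree ∧ D ≠ 0 ∧ e ≠ 0 ∧
      A * H + B * derivative F = C D ∧ H * Q = C e * F := by
  have hinj : Function.Injective (algebraMap ℤ ℚ) := Int.cast_injective
  have hzQ : aeval z (F.map (algebraMap ℤ ℚ)) = 0 := by rwa [aeval_map_algebraMap]
  have hint : IsIntegral ℚ z := isAlgebraic_iff_isIntegral.1
    ⟨_, (Polynomial.map_ne_zero_iff hinj).2 hF, hzQ⟩
  have hcop : IsCoprime (minpoly ℚ z) ((derivative F).map (algebraMap ℤ ℚ)) := by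
    rw [(minpoly.irreducible hint).coprime_iff_not_dvd, minpoly.dvd_iff, aeval_map_algebraMap]
    exact hz'
  obtain ⟨u, v, huv⟩ := hcop
  obtain ⟨q, hq⟩ := minpoly.dvd ℚ z hzQ
  have clear (p : ℚ[X]) : ∃ (b : ℤ) (p' : ℤ[X]), b ≠ 0 ∧
      p'.map (algebraMap ℤ ℚ) = C (algebraMap ℤ ℚ b) * p := by
    obtain ⟨b, hb, h⟩ := IsLocalization.integerNormalization_spec (nonZeroDivisors ℤ) p
    refine ⟨b, _, nonZeroDivisors.ne_zero hb, h.trans ?_⟩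
    rw [← smul_eq_C_mul, algebraMap_smul]
  obtain ⟨a, A, ha, hA⟩ := clear u
  obtain ⟨b, H, hb, hH⟩ := clear (minpoly ℚ z)
  obtain ⟨c, B, hc, hB⟩ := clear v
  obtain ⟨d, Q, hd, hQ⟩ := clear q
  refine ⟨H, C c * A, C (a * b) * B, Q, a * b * c, b * d, ?_, by positivity, by positivity,
    map_injective _ hinj ?_, map_injective _ hinj ?_⟩
  · rw [← natDegree_map_eq_of_injective hinj, hH, natDegree_C_mul ((map_ne_zero_iff _ hinj).2 hb)]
    exact minpoly.natDegree_pos hint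
  · simp only [Polynomial.map_add, Polynomial.map_mul, map_C, hA, hH, hB, C_mul]
    linear_combination (C (algebraMap ℤ ℚ a) * C (algebraMap ℤ ℚ b) * C (algebraMap ℤ ℚ c)) * huv
  · simp only [Polynomial.map_mul, map_C, hH, hQ, C_mul, hq]
    ring

lemma ZMod.intCast_ne_zero_of_natAbs_lt {a : ℤ} (ha : a ≠ 0) {ℓ : ℕ} (h : a.natAbs < ℓ) :
    (a : ZMod ℓ) ≠ 0 := by
  rw [Ne, ZMod.intCast_zmod_eq_zero_iff_dvd, Int.natCast_dvd]
  exact fun hdvd => (Nat.le_of_dvd (Int.natAbs_pos.2 ha) hdvd).not_gt h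

lemma intCast_ne_zero_of_natAbs_lt {a : ℤ} (ha : a ≠ 0) {ℓ : ℕ} [Fact ℓ.Prime]
    {K : Type*} [Field K] [Algebra (ZMod ℓ) K] (h : a.natAbs < ℓ) : (a : K) ≠ 0 := by
  rw [← map_intCast (algebraMap (ZMod ℓ) K), _root_.map_ne_zero]
  exact ZMod.intCast_ne_zero_of_natAbs_lt ha h

lemma exists_simple_root_of_not_squarefullPoly {F : ℤ[X]} (hF : 0 < F.natDegree)
    (hFsf : ¬ SquarefullPoly F) :
    ∃ κ : ℕ, ∀ (ℓ : ℕ) [Fact ℓ.Prime], κ < ℓ → ∀ (K : Type) [Field K] [IsAlgClosed K]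
      [Algebra (ZMod ℓ) K], ∃ α : K, (F.map (Int.castRingHom K)).IsRoot α ∧
        ¬ (derivative (F.map (Int.castRingHom K))).IsRoot α := by
  have hF0 : F ≠ 0 := by rintro rfl; simp at hF
  obtain ⟨z, hz, hz'⟩ : ∃ z : ℂ, aeval z F = 0 ∧ aeval z (derivative F) ≠ 0 := by
    simp only [SquarefullPoly, not_forall, not_le] at hFsf
    obtain ⟨z, hz, hlt⟩ := hFsf
    have h0 : F.map (Int.castRingHom ℂ) ≠ 0 :=
      (Polynomial.map_ne_zero_iff Int.cast_injective).2 hF0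
    refine ⟨z, ?_, fun h => hlt.not_ge ((one_lt_rootMultiplicity_iff_isRoot h0).2 ⟨hz, ?_⟩)⟩
    · rwa [← eval_map_algebraMap]
    · rwa [← eval_map_algebraMap, ← derivative_map] at h
  obtain ⟨H, A, B, Q, D, e, hH, hD, he, hAB, hHQ⟩ := exists_bezout_of_simple_root hz hz' hF0
  have hlc : H.leadingCoeff ≠ 0 := by
    rw [leadingCoeff_ne_zero]; rintro rfl; simp at hH
  refine ⟨max H.leadingCoeff.natAbs (max D.natAbs e.natAbs), fun ℓ _ hℓ K _ _ _ => ?_⟩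
  simp only [max_lt_iff] at hℓ
  have hdeg : (H.map (Int.castRingHom K)).natDegree = H.natDegree :=
    natDegree_map_of_leadingCoeff_ne_zero _ (intCast_ne_zero_of_natAbs_lt hlc hℓ.1)
  obtain ⟨α, hα⟩ := IsAlgClosed.exists_root (H.map (Int.castRingHom K))
    (natDegree_pos_iff_degree_pos.1 (hdeg ▸ hH)).ne'
  have h1 := congrArg (fun p => eval α (p.map (Int.castRingHom K))) hAB
  have h2 := congrArg (fun p => eval α (p.map (Int.castRingHom K))) hHQ
  simp only [Polynomial.map_add, Polynomial.map_mul, eval_add, eval_mul, hα.eq_zero, mul_zero,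
    zero_mul, zero_add, map_C, eval_C] at h1 h2
  rw [eq_intCast] at h1 h2
  refine ⟨α, ((mul_eq_zero.1 h2.symm).resolve_left (intCast_ne_zero_of_natAbs_lt he hℓ.2.2)), ?_⟩
  intro h
  rw [derivative_map] at h
  rw [h.eq_zero, mul_zero] at h1
  exact intCast_ne_zero_of_natAbs_lt hD hℓ.2.1 h1.symm

lemma Polynomial.coeff_X_mul_derivative_mul {R : Type*} [CommRing R] (p q : R[X]) :
    (X * derivative p * q).coeff (p.natDegree + q.natDegree) =
      p.natDegree * (p.leadingCoeff * q.leadingCoeff) := by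
  have hcoeff (n : ℕ) : (X * derivative p).coeff n = n * p.coeff n := by
    cases n with
    | zero => simp
    | succ n => rw [coeff_X_mul, coeff_derivative]; push_cast; ring
  rw [coeff_mul_add_eq_of_natDegree_le _ le_rfl, hcoeff, leadingCoeff, leadingCoeff, mul_assoc]
  rw [natDegree_le_iff_coeff_eq_zero]
  intro n hn
  rw [hcoeff, coeff_eq_zero_of_natDegree_lt hn, mul_zero]

lemma Polynomial.natDegree_eq_of_derivative_mul_eq {k : Type*} [Field k] [CharZero k] {p q : k[X]}
    (hp : p ≠ 0) (hq : q ≠ 0) (h : derivative p * q = p * derivative q) :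
    p.natDegree = q.natDegree := by
  have h1 := coeff_X_mul_derivative_mul p q
  have h2 := coeff_X_mul_derivative_mul q p
  rw [show X * derivative q * p = X * derivative p * q by linear_combination -X * h, add_comm, h1,
    mul_comm q.leadingCoeff] at h2
  exact_mod_cast mul_right_cancel₀
    (mul_ne_zero (leadingCoeff_ne_zero.2 hp) (leadingCoeff_ne_zero.2 hq)) h2

lemma Polynomial.exists_eq_C_mul_of_derivative_mul_eq {k : Type*} [Field k] [CharZero k]
    {p q : k[X]} (hq : q ≠ 0) (h : derivative p * q = p * derivative q) :
    ∃ r, p = C r * q := by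
  by_cases hp : p = 0
  · exact ⟨0, by simp [hp]⟩
  have hplc := leadingCoeff_ne_zero.2 hp
  have hqlc := leadingCoeff_ne_zero.2 hq
  set r := p.leadingCoeff / q.leadingCoeff with hr
  have hr0 : r ≠ 0 := div_ne_zero hplc hqlc
  refine ⟨r, by_contra fun hne => ?_⟩
  have hlt : (p - C r * q).degree < p.degree := by
    refine degree_sub_lt_left ?_ hp ?_
    · rw [degree_C_mul hr0, degree_eq_natDegree hp, degree_eq_natDegree hq,
        natDegree_eq_of_derivative_mul_eq hp hq h]
    · rw [leadingCoeff_mul, leadingCoeff_C, hr, div_mul_cancel₀ _ hqlc]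
  have hsub := sub_ne_zero.2 hne
  have hdeg := natDegree_eq_of_derivative_mul_eq hsub hq (by
    rw [derivative_sub, derivative_C_mul]
    linear_combination h)
  rw [← natDegree_eq_of_derivative_mul_eq hp hq h] at hdeg
  rw [degree_eq_natDegree hsub, degree_eq_natDegree hp, hdeg] at hlt
  exact lt_irrefl _ hlt

lemma MultIndep.ne_zero_right {F G : ℤ[X]} (h : MultIndep ![F, G]) : G ≠ 0 := by
  rintro rfl
  exact h ⟨![0, 1], fun h => one_ne_zero (congrFun h 1), 0, by simp [Fin.prod_univ_two]⟩

lemma MultIndep.natDegree_mul_derivative_ne {F G : ℤ[X]} (hF : 0 < F.natDegree)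
    (hMI : MultIndep ![F, G]) :
    (F.natDegree : ℤ[X]) * (F * derivative G) - G.natDegree * (derivative F * G) ≠ 0 := by
  intro h
  set m := F.natDegree with hm
  set n := G.natDegree with hn
  set f : ℚ[X] := F.map (Int.castRingHom ℚ) with hf
  set g : ℚ[X] := G.map (Int.castRingHom ℚ) with hg
  have hf0 : f ≠ 0 := by
    rw [hf, Polynomial.map_ne_zero_iff Int.cast_injective]
    rintro rfl; simp at hm; omega
  have hfg : (m : ℚ[X]) * (f * derivative g) = n * (derivative f * g) := by
    have := congrArg (Polynomial.map (Int.castRingHom ℚ)) h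
    simpa [← derivative_map, sub_eq_zero] using this
  obtain ⟨r, hr⟩ := exists_eq_C_mul_of_derivative_mul_eq (p := g ^ m) (q := f ^ n)
    (pow_ne_zero _ hf0) (by
      refine mul_left_cancel₀ hf0 ?_
      obtain ⟨k, hk⟩ := Nat.exists_eq_add_of_lt hF
      rw [zero_add] at hk
      rw [derivative_pow, derivative_pow, hk, Nat.add_sub_cancel, ← hk]
      rcases hn0 : n with _ | j
      · rw [hn0] at hfg
        simp only [C_eq_natCast, pow_zero, mul_one, Nat.cast_zero, zero_mul, mul_zero, C_0] at hfg ⊢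
        linear_combination g ^ k * hfg
      · rw [hn0] at hfg
        simp only [C_eq_natCast, Nat.add_sub_cancel]
        rw [hk, pow_succ g, pow_succ f, ← hk]
        linear_combination g ^ k * f ^ j * f * hfg)
  refine hMI ⟨![-n, m], fun h => ?_, r, ?_⟩
  · have := congrFun h 1
    simp at this
    omega
  · have hf1 : algebraMap ℚ[X] (RatFunc ℚ) f ≠ 0 := by simpa using hf0
    simp only [Fin.prod_univ_two, Matrix.cons_val_zero, Matrix.cons_val_one, zpow_neg,
      zpow_natCast]
    rw [← hf, ← hg, ← map_pow _ g, hr, map_mul, map_pow, mul_comm, mul_assoc,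
      mul_inv_cancel₀ (pow_ne_zero _ hf1), mul_one, RatFunc.algebraMap_C]
    simp

lemma logDeriv_eq_of_dvd {K : Type*} [Field K] {f g : K[X]} {u w : K} (hu : u ≠ 0) (hw : w ≠ 0)
    (hdvd : ((∏ i : Fin 3, (aeval (MvPolynomial.X i) f : MvPolynomial (Fin 3) K)) -
      MvPolynomial.C u) ∣ ((∏ i : Fin 3, (aeval (MvPolynomial.X i) g : MvPolynomial (Fin 3) K)) -
      MvPolynomial.C w)) {x y z : K} (h : f.eval x * f.eval y * f.eval z = u) :
    f.eval x * (derivative g).eval x * ((derivative f).eval y * g.eval y) =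
      (derivative f).eval x * g.eval x * (f.eval y * (derivative g).eval y) := by
  obtain ⟨R, hR⟩ := hdvd
  have eval_aeval (i : Fin 3) (p : K[X]) :
      MvPolynomial.eval ![x, y, z] (aeval (MvPolynomial.X i) p) = p.eval (![x, y, z] i) := by
    rw [← MvPolynomial.coe_aeval_eq_eval, RingHom.coe_coe, ← aeval_algHom_apply,
      MvPolynomial.aeval_X, coe_aeval_eq_eval]
  have h0 := congrArg (MvPolynomial.eval ![x, y, z]) hR
  have h1 := congrArg (fun p => MvPolynomial.eval ![x, y, z] (MvPolynomial.pderiv 0 p)) hR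
  have h2 := congrArg (fun p => MvPolynomial.eval ![x, y, z] (MvPolynomial.pderiv 1 p)) hR
  simp [Fin.prod_univ_three, Derivation.map_aeval, eval_aeval, MvPolynomial.pderiv_X, h,
    sub_eq_zero] at h0 h1 h2
  have hg : g.eval z ≠ 0 := by rintro h; simp [h] at h0; exact hw h0.symm
  have hf : f.eval z ≠ 0 := by rintro h'; simp [h'] at h; exact hu h.symm
  refine mul_right_cancel₀ (mul_ne_zero hg hf) ?_
  linear_combination f.eval x * (derivative f).eval y * f.eval z * h1 -
    (derivative f).eval x * f.eval y * f.eval z * h2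

lemma natDegree_mul_eq_of_dvd {K : Type*} [Field K] [IsAlgClosed K] {f g : K[X]} {u w : K}
    (hf : 0 < f.natDegree) (hg : g ≠ 0) (hu : u ≠ 0) (hw : w ≠ 0)
    (hdvd : ((∏ i : Fin 3, (aeval (MvPolynomial.X i) f : MvPolynomial (Fin 3) K)) -
      MvPolynomial.C u) ∣ ((∏ i : Fin 3, (aeval (MvPolynomial.X i) g : MvPolynomial (Fin 3) K)) -
      MvPolynomial.C w)) :
    (f.natDegree : K[X]) * (f * derivative g) = g.natDegree * (derivative f * g) := by
  have hf0 : f ≠ 0 := by rintro rfl; simp at hf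
  have hxy (x y : K) (hy : f.eval y ≠ 0) :
      f.eval x * (f.eval x * (derivative g).eval x * ((derivative f).eval y * g.eval y)) =
        f.eval x * ((derivative f).eval x * g.eval x * (f.eval y * (derivative g).eval y)) := by
    by_cases hx : f.eval x = 0
    · rw [hx, zero_mul, zero_mul]
    obtain ⟨z, hz⟩ := IsAlgClosed.exists_root (f - C (u / (f.eval x * f.eval y))) 
      (natDegree_pos_iff_degree_pos.1 (by rwa [natDegree_sub_C])).ne'
    rw [logDeriv_eq_of_dvd hu hw hdvd (x := x) (y := y) (z := z)]
    rw [IsRoot, eval_sub, eval_C, sub_eq_zero] at hz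
    rw [hz, mul_div_cancel₀ _ (mul_ne_zero hx hy)]
  have hy (y : K) (hy : f.eval y ≠ 0) :
      (f.natDegree : K) * (f.eval y * (derivative g).eval y) =
        g.natDegree * ((derivative f).eval y * g.eval y) := by
    have hpoly : f * derivative g * C ((derivative f).eval y * g.eval y) =
        derivative f * g * C (f.eval y * (derivative g).eval y) := by
      refine mul_left_cancel₀ hf0 (Polynomial.funext fun x => ?_)
      simpa using hxy x y hy
    have h1 := coeff_X_mul_derivative_mul f g
    have h2 := coeff_X_mul_derivative_mul g f
    have h3 := congrArg (fun p => (X * p).coeff (f.natDegree + g.natDegree)) hpoly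
    simp only [← mul_assoc, coeff_mul_C] at h3
    rw [h1, show X * f * derivative g = X * derivative g * f by ring, add_comm, h2] at h3
    refine mul_right_cancel₀
      (mul_ne_zero (leadingCoeff_ne_zero.2 hf0) (leadingCoeff_ne_zero.2 hg)) ?_
    linear_combination -h3
  refine mul_left_cancel₀ hf0 (Polynomial.funext fun y => ?_)
  by_cases h0 : f.eval y = 0
  · simp [h0]
  · simpa using Or.inl (hy y h0)

theorem absolute_irreducibility
    (F G : Polynomial ℤ)
    (hFnc : 0 < F.natDegree)
    (hFsf : ¬ SquarefullPoly F)
    (hMI : MultIndep ![F, G]) :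
    ∃ κ₀ κ₁ : ℕ,
      (∀ N : ℕ, 2 ≤ N → ∀ (ℓ : ℕ) [Fact ℓ.Prime], κ₀ < ℓ →
        ∀ w : (ZMod ℓ)ˣ,
          Irreducible
            ((∏ i : Fin N,
                (Polynomial.aeval (MvPolynomial.X i) F :
                  MvPolynomial (Fin N) (AlgebraicClosure (ZMod ℓ)))) -
              MvPolynomial.C
                (algebraMap (ZMod ℓ) (AlgebraicClosure (ZMod ℓ)) (w : ZMod ℓ)))) ∧
      (∀ (ℓ : ℕ) [Fact ℓ.Prime], κ₁ < ℓ →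
        ∀ u w : (ZMod ℓ)ˣ,
          Irreducible
            ((∏ i : Fin 3,
                (Polynomial.aeval (MvPolynomial.X i) F :
                  MvPolynomial (Fin 3) (AlgebraicClosure (ZMod ℓ)))) -
              MvPolynomial.C
                (algebraMap (ZMod ℓ) (AlgebraicClosure (ZMod ℓ)) (u : ZMod ℓ))) ∧
          ¬ ((∏ i : Fin 3,
                (Polynomial.aeval (MvPolynomial.X i) F :
                  MvPolynomial (Fin 3) (AlgebraicClosure (ZMod ℓ)))) -
              MvPolynomial.C
                (algebraMap (ZMod ℓ) (AlgebraicClosure (ZMod ℓ)) (u : ZMod ℓ))) ∣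
            ((∏ i : Fin 3,
                (Polynomial.aeval (MvPolynomial.X i) G :
                  MvPolynomial (Fin 3) (AlgebraicClosure (ZMod ℓ)))) -
              MvPolynomial.C
                (algebraMap (ZMod ℓ) (AlgebraicClosure (ZMod ℓ)) (w : ZMod ℓ)))) := by
  obtain ⟨κ, hκ⟩ := exists_simple_root_of_not_squarefullPoly hFnc hFsf
  have aeval_eq (ℓ : ℕ) [Fact ℓ.Prime] (N : ℕ) (i : Fin N) (P : ℤ[X]) :
      (aeval (MvPolynomial.X i) P : MvPolynomial (Fin N) (AlgebraicClosure (ZMod ℓ))) =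
        aeval (MvPolynomial.X i) (P.map (Int.castRingHom (AlgebraicClosure (ZMod ℓ)))) :=
    (aeval_map_algebraMap _ _ _).symm
  have unit_ne_zero (ℓ : ℕ) [Fact ℓ.Prime] (w : (ZMod ℓ)ˣ) :
      algebraMap (ZMod ℓ) (AlgebraicClosure (ZMod ℓ)) (w : ZMod ℓ) ≠ 0 := by
    rw [_root_.map_ne_zero]
    exact w.ne_zero
  have irred (N : ℕ) (hN : 2 ≤ N) (ℓ : ℕ) [Fact ℓ.Prime] (hℓ : κ < ℓ) (w : (ZMod ℓ)ˣ) :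
      Irreducible
        ((∏ i : Fin N,
          (Polynomial.aeval (MvPolynomial.X i) F :
            MvPolynomial (Fin N) (AlgebraicClosure (ZMod ℓ)))) -
          MvPolynomial.C
            (algebraMap (ZMod ℓ) (AlgebraicClosure (ZMod ℓ)) (w : ZMod ℓ))) := by
    obtain ⟨α, hα, hα'⟩ := hκ ℓ hℓ (AlgebraicClosure (ZMod ℓ))
    simp_rw [aeval_eq]
    exact irreducible_prod_aeval_sub_C hα hα' (unit_ne_zero ℓ w) hN
  have hF0 : F ≠ 0 := by rintro rfl; simp at hFnc
  have hne := hMI.natDegree_mul_derivative_ne hFnc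
  set P := (F.natDegree : ℤ[X]) * (F * derivative G) - G.natDegree * (derivative F * G) with hP
  refine ⟨κ, max κ (max F.leadingCoeff.natAbs (max G.leadingCoeff.natAbs P.leadingCoeff.natAbs)),
    irred, fun ℓ _ hℓ u w => ?_⟩
  simp only [max_lt_iff] at hℓ
  obtain ⟨hκℓ, hFℓ, hGℓ, hPℓ⟩ := hℓ
  refine ⟨irred 3 (by norm_num) ℓ hκℓ u, fun hdvd => ?_⟩
  have hFlc : (F.leadingCoeff : AlgebraicClosure (ZMod ℓ)) ≠ 0 :=
    intCast_ne_zero_of_natAbs_lt (leadingCoeff_ne_zero.2 hF0) hFℓ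
  have hGlc : (G.leadingCoeff : AlgebraicClosure (ZMod ℓ)) ≠ 0 :=
    intCast_ne_zero_of_natAbs_lt (leadingCoeff_ne_zero.2 hMI.ne_zero_right) hGℓ
  have hPlc : (P.leadingCoeff : AlgebraicClosure (ZMod ℓ)) ≠ 0 :=
    intCast_ne_zero_of_natAbs_lt (leadingCoeff_ne_zero.2 hne) hPℓ
  set φ := Int.castRingHom (AlgebraicClosure (ZMod ℓ)) with hφ
  have hFdeg : (F.map φ).natDegree = F.natDegree := natDegree_map_of_leadingCoeff_ne_zero _ hFlc
  have hGdeg : (G.map φ).natDegree = G.natDegree := natDegree_map_of_leadingCoeff_ne_zero _ hGlc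
  have hG0 : G.map φ ≠ 0 := fun h => hGlc (by
    have := congrArg (fun p => p.coeff G.natDegree) h
    simpa [hφ] using this)
  simp_rw [aeval_eq] at hdvd
  have key := natDegree_mul_eq_of_dvd (hFdeg ▸ hFnc) hG0 (unit_ne_zero ℓ u) (unit_ne_zero ℓ w) hdvd
  have hP0 : P.map φ = 0 := by
    rw [hFdeg, hGdeg] at key
    simp only [hP, Polynomial.map_sub, Polynomial.map_mul, Polynomial.map_natCast,
      ← derivative_map]
    exact sub_eq_zero.2 key
  refine hPlc ?_
  have := congrArg (fun p => p.coeff P.natDegree) hP0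
  simpa [hφ] using this
end
end

section
/- Let F ∈ ℤ[T] be a fixed nonconstant polynomial that is not squarefull in ℤ[T]. (a) There exists a constant A = A(F) > 0 such that for every prime ℓ and every w ∈ U_ℓ: #{(v_1, v_2) ∈ U_ℓ^2 : F(v_1)F(v_2) ≡ w (mod ℓ)} ≤ φ(ℓ)·(1 + A·ℓ^{−1/2}). (b) If moreover G ∈ ℤ[T] is a fixed polynomial such that F and G are multiplicatively independent, then there exists a constant A' = A'(F, G) > 0 such that for every prime ℓ and all u, w ∈ U_ℓ: #{(v_1, v_2, v_3) ∈ U_ℓ^3 : F(v_1)F(v_2)F(v_3) ≡ u (mod ℓ) and G(v_1)G(v_2)G(v_3) ≡ w (mod ℓ)} ≤ A'·φ(ℓ). -/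
open Polynomial
open scoped Classical

noncomputable section

/-- The span of the monomials `x ^ i * y ^ j` with `i < L` and `j < d`. -/
def monomialBox (k : Type*) {E : Type*} [Field k] [CommRing E] [Algebra k E]
    (x y : E) (L d : ℕ) : Submodule k E :=
  Submodule.span k (Set.range fun a : Fin L × Fin d => x ^ (a.1 : ℕ) * y ^ (a.2 : ℕ))

section monomialBox

variable {k E E' : Type*} [Field k] [CommRing E] [Algebra k E] [CommRing E'] [Algebra k E']
  {x y : E} {L L' d d' : ℕ}

theorem monomial_mem_monomialBox {i j : ℕ} (hi : i < L) (hj : j < d) :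
    x ^ i * y ^ j ∈ monomialBox k x y L d :=
  Submodule.subset_span ⟨(⟨i, hi⟩, ⟨j, hj⟩), rfl⟩

theorem monomialBox_le {p : Submodule k E}
    (h : ∀ i < L, ∀ j < d, x ^ i * y ^ j ∈ p) : monomialBox k x y L d ≤ p := by
  refine Submodule.span_le.2 ?_
  rintro _ ⟨a, rfl⟩
  exact h _ a.1.2 _ a.2.2

theorem monomialBox_mono (hL : L ≤ L') (hd : d ≤ d') :
    monomialBox k x y L d ≤ monomialBox k x y L' d' :=
  monomialBox_le fun _ hi _ hj => monomial_mem_monomialBox (hi.trans_le hL) (hj.trans_le hd)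

instance : Module.Finite k (monomialBox k x y L d) :=
  Module.Finite.span_of_finite k (Set.finite_range _)

theorem finrank_monomialBox_le : Module.finrank k (monomialBox k x y L d) ≤ L * d := by
  refine (finrank_range_le_card _).trans ?_
  simp

theorem finrank_monomialBox
    (h : LinearIndependent k fun a : Fin L × Fin d => x ^ (a.1 : ℕ) * y ^ (a.2 : ℕ)) :
    Module.finrank k (monomialBox k x y L d) = L * d := by
  rw [monomialBox, finrank_span_eq_card h]
  simp

theorem mul_mem_monomialBox_of_monomial {g h : E} {p : Submodule k E}
    (hg : ∀ i < L, ∀ j < d, g * (x ^ i * y ^ j) ∈ p) (hh : h ∈ monomialBox k x y L d) :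
    g * h ∈ p := by
  have : monomialBox k x y L d ≤ p.comap (LinearMap.mulLeft k g) := monomialBox_le hg
  exact this hh

theorem mul_mem_monomialBox {g h : E} {a b : ℕ} (hg : g ∈ monomialBox k x y (a + 1) (b + 1))
    (hh : h ∈ monomialBox k x y L d) : g * h ∈ monomialBox k x y (a + L) (b + d) := by
  refine mul_mem_monomialBox_of_monomial (fun i hi j hj => ?_) hh
  rw [mul_comm]
  refine mul_mem_monomialBox_of_monomial (fun i' hi' j' hj' => ?_) hg
  have : x ^ i * y ^ j * (x ^ i' * y ^ j') = x ^ (i + i') * y ^ (j + j') := by ring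
  rw [this]
  exact monomial_mem_monomialBox (by omega) (by omega)

theorem map_monomialBox (f : E →ₐ[k] E') :
    (monomialBox k x y L d).map f.toLinearMap = monomialBox k (f x) (f y) L d := by
  rw [monomialBox, Submodule.map_span, ← Set.range_comp, monomialBox]
  congr 2
  ext a
  simp

theorem map_mem_monomialBox (f : E →ₐ[k] E') {h : E} (hh : h ∈ monomialBox k x y L d) :
    f h ∈ monomialBox k (f x) (f y) L d := by
  rw [← map_monomialBox]
  exact Submodule.mem_map_of_mem hh

theorem aeval_left_mem_monomialBox {p : k[X]} {n : ℕ} (hp : p.natDegree ≤ n) :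
    aeval x p ∈ monomialBox k x y (n + 1) 1 := by
  rw [aeval_eq_sum_range]
  refine Submodule.sum_mem _ fun i hi => Submodule.smul_mem _ _ ?_
  have hi : i < p.natDegree + 1 := by simpa using hi
  simpa using monomial_mem_monomialBox (k := k) (x := x) (y := y) (i := i) (j := 0)
    (L := n + 1) (by omega) one_pos

theorem aeval_right_mem_monomialBox {p : k[X]} {n : ℕ} (hp : p.natDegree ≤ n) :
    aeval y p ∈ monomialBox k x y 1 (n + 1) := by
  rw [aeval_eq_sum_range]
  refine Submodule.sum_mem _ fun i hi => Submodule.smul_mem _ _ ?_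
  have hi : i < p.natDegree + 1 := by simpa using hi
  simpa using monomial_mem_monomialBox (k := k) (x := x) (y := y) (i := 0) (j := i)
    (d := n + 1) one_pos (by omega)

/-- On the curve `F₁(x) F₂(y) = w`, a power of `F₁(x)` clears the powers `y ^ j` with
`j ≥ deg F₂`. -/
theorem pow_mul_mem_monomialBox {F₁ F₂ : k[X]} {n : ℕ} {w : k} (hn : 0 < n)
    (h₁ : F₁.natDegree ≤ n) (h₂ : F₂.natDegree = n)
    (hxy : aeval x F₁ * aeval y F₂ = algebraMap k E w) (m : ℕ) :
    ∀ {L : ℕ} {h : E}, h ∈ monomialBox k x y L (n + m) →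
      aeval x F₁ ^ m * h ∈ monomialBox k x y (L + n * m) n := by
  induction m with
  | zero => intro L h hh; simpa using hh
  | succ m ih =>
    intro L h hh
    suffices hs : aeval x F₁ * h ∈ monomialBox k x y (L + n) (n + m) by
      have := ih hs
      rw [pow_succ, mul_assoc]
      convert this using 2
      ring
    have hF₁ := aeval_left_mem_monomialBox (x := x) (y := y) h₁
    refine mul_mem_monomialBox_of_monomial (fun i hi j hj => ?_) hh
    rcases Nat.lt_or_ge j (n + m) with hj' | hj'
    · have := mul_mem_monomialBox hF₁
        (monomial_mem_monomialBox (k := k) (x := x) (y := y) hi hj')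
      exact monomialBox_mono (by omega) (by omega) this
    · obtain rfl : j = n + m := by omega
      have hlc : F₂.leadingCoeff ≠ 0 := by
        rw [leadingCoeff_ne_zero]; rintro rfl; simp at h₂; omega
      have hsplit : aeval y F₂ = aeval y F₂.eraseLead + F₂.leadingCoeff • y ^ n := by
        conv_lhs => rw [← F₂.eraseLead_add_C_mul_X_pow]
        simp [h₂, Algebra.smul_def]
      rw [← Submodule.smul_mem_iff _ hlc]
      have key : F₂.leadingCoeff • (aeval x F₁ * (x ^ i * y ^ (n + m))) =
          w • (x ^ i * y ^ m) - aeval x F₁ * (aeval y F₂.eraseLead * (x ^ i * y ^ m)) := by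
        rw [Algebra.smul_def w, ← hxy, hsplit]
        simp only [Algebra.smul_def]
        ring
      rw [key]
      have he : F₂.eraseLead.natDegree ≤ n - 1 := h₂ ▸ F₂.eraseLead_natDegree_le
      refine Submodule.sub_mem _ (Submodule.smul_mem _ _
        (monomial_mem_monomialBox (by omega) (by omega))) ?_
      have h1 := mul_mem_monomialBox (aeval_right_mem_monomialBox (x := x) (y := y) he)
        (monomial_mem_monomialBox (k := k) (x := x) (y := y) hi (Nat.lt_succ_self m))
      have h2 := mul_mem_monomialBox hF₁ h1
      exact monomialBox_mono (by omega) (by omega) h2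

end monomialBox

section LaurentSeries

variable {k : Type*} [Field k]

instance LaurentSeries.instAlgebraCoeff : Algebra k (LaurentSeries k) :=
  HahnSeries.instAlgebra

instance LaurentSeries.isScalarTower_powerSeries :
    IsScalarTower k (PowerSeries k) (LaurentSeries k) :=
  IsScalarTower.of_algebraMap_eq fun r => by
    rw [LaurentSeries.coe_algebraMap, ← PowerSeries.C_eq_algebraMap, PowerSeries.coe_C]
    exact HahnSeries.algebraMap_apply

theorem HahnSeries.linearIndependent_of_injective_order {ι : Type*} {v : ι → LaurentSeries k}
    (h0 : ∀ i, v i ≠ 0) (hv : Function.Injective fun i => (v i).order) :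
    LinearIndependent k v := by
  rw [linearIndependent_iff']
  intro s g hg
  by_contra! hne
  obtain ⟨i₀, hi₀, hgi₀⟩ := hne
  obtain ⟨i, hi, hmin⟩ := (s.filter fun i => g i ≠ 0).exists_min_image (fun i => (v i).order)
    ⟨i₀, by simp [hi₀, hgi₀]⟩
  rw [Finset.mem_filter] at hi
  have hc := congrArg (fun z : LaurentSeries k => z.coeff (v i).order) hg
  simp only [HahnSeries.coeff_sum, HahnSeries.coeff_smul, HahnSeries.coeff_zero] at hc
  rw [Finset.sum_eq_single_of_mem i hi.1] at hc
  · rcases smul_eq_zero.1 hc with h | h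
    · exact hi.2 h
    · exact h0 i (HahnSeries.coeff_order_eq_zero.1 h)
  · intro j hj hji
    by_cases hgj : g j = 0
    · simp [hgj]
    · rw [HahnSeries.coeff_eq_zero_of_lt_order, smul_zero]
      exact lt_of_le_of_ne (hmin j (by simp [hj, hgj])) fun h => hji (hv h.symm)

theorem LaurentSeries.order_algebraMap_eq_zero {z : PowerSeries k}
    (hz : PowerSeries.constantCoeff z ≠ 0) :
    (algebraMap (PowerSeries k) (LaurentSeries k) z).order = 0 := by
  have h0 : (algebraMap (PowerSeries k) (LaurentSeries k) z).coeff 0 ≠ 0 := by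
    have := LaurentSeries.coeff_coe_powerSeries z 0
    rw [LaurentSeries.coe_algebraMap]
    simpa using this.trans_ne (by simpa using hz)
  refine le_antisymm (HahnSeries.order_le_of_coeff_ne_zero h0) ?_
  by_contra! hlt
  have hne : algebraMap (PowerSeries k) (LaurentSeries k) z ≠ 0 := by
    intro h; rw [h] at h0; simp at h0
  have h1 := HahnSeries.coeff_order_eq_zero.not.2 hne
  rw [LaurentSeries.coe_algebraMap] at h1 hlt
  rw [PowerSeries.coeff_coe, if_pos hlt] at h1
  exact h1 rfl

theorem LaurentSeries.aeval_single_neg_one (q : k[X]) :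
    aeval (HahnSeries.single (-1) 1 : LaurentSeries k) q =
      algebraMap (PowerSeries k) (LaurentSeries k) (aeval PowerSeries.X q.reverse) *
        (HahnSeries.single (-1) 1) ^ q.natDegree := by
  set y : LaurentSeries k := HahnSeries.single (-1) 1 with hy
  set t : LaurentSeries k := HahnSeries.single 1 1 with ht
  have hyt : y * t = 1 := by simp [hy, ht, HahnSeries.single_mul_single]
  let _ : Invertible y := ⟨t, (mul_comm t y).trans hyt, hyt⟩
  rw [← aeval_algebraMap_apply, LaurentSeries.coe_algebraMap, PowerSeries.coe_X]
  exact (eval₂_reverse_mul_pow (algebraMap k (LaurentSeries k)) y q).symm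

theorem constantCoeff_aeval_powerSeriesX_reverse {q : k[X]} (hq : q ≠ 0) :
    PowerSeries.constantCoeff (aeval (PowerSeries.X : PowerSeries k) q.reverse) ≠ 0 := by
  rw [Polynomial.aeval_def, Polynomial.hom_eval₂]
  simp [PowerSeries.constantCoeff_X, hq]

theorem LaurentSeries.algebraMap_ne_zero {z : PowerSeries k}
    (hz : PowerSeries.constantCoeff z ≠ 0) :
    algebraMap (PowerSeries k) (LaurentSeries k) z ≠ 0 := by
  rw [Ne, map_eq_zero_iff _ (FaithfulSMul.algebraMap_injective _ _)]
  rintro rfl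
  simp at hz

theorem LaurentSeries.order_aeval_single_neg_one {q : k[X]} (hq : q ≠ 0) :
    (aeval (HahnSeries.single (-1) 1 : LaurentSeries k) q).order = -(q.natDegree : ℤ) := by
  have hc := constantCoeff_aeval_powerSeriesX_reverse hq
  rw [LaurentSeries.aeval_single_neg_one, HahnSeries.order_mul
    (LaurentSeries.algebraMap_ne_zero hc) (pow_ne_zero _ (HahnSeries.single_ne_zero one_ne_zero)),
    LaurentSeries.order_algebraMap_eq_zero hc, HahnSeries.order_pow,
    HahnSeries.order_single one_ne_zero]
  simp

theorem exists_X_pow_mul_eq_constantCoeff_aeval_ne_zero {z : PowerSeries k}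
    (hz : PowerSeries.constantCoeff z = 0) {q : k[X]} (hq : q ≠ 0) :
    ∃ r : k[X], q = X ^ q.natTrailingDegree * r ∧ PowerSeries.constantCoeff (aeval z r) ≠ 0 := by
  obtain ⟨r, hr⟩ : X ^ q.natTrailingDegree ∣ q :=
    X_pow_dvd_iff.2 fun d hd => coeff_eq_zero_of_lt_natTrailingDegree hd
  refine ⟨r, hr, ?_⟩
  have hr0 : r.coeff 0 ≠ 0 := by
    have h1 : q.coeff q.natTrailingDegree ≠ 0 := trailingCoeff_nonzero_iff_nonzero.2 hq
    rw [hr, coeff_X_pow_mul', ← hr] at h1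
    simpa using h1
  rw [Polynomial.aeval_def, Polynomial.hom_eval₂]
  have : (PowerSeries.constantCoeff).comp (algebraMap k (PowerSeries k)) = RingHom.id k := by
    ext; simp
  simpa [this, hz, ← coeff_zero_eq_eval_zero] using hr0

theorem LaurentSeries.order_aeval_algebraMap {z : PowerSeries k}
    (hz : PowerSeries.constantCoeff z = 0) {q : k[X]} (hq : q ≠ 0)
    (hz0 : algebraMap (PowerSeries k) (LaurentSeries k) z ≠ 0) :
    (aeval (algebraMap (PowerSeries k) (LaurentSeries k) z) q).order =
      q.natTrailingDegree * (algebraMap (PowerSeries k) (LaurentSeries k) z).order := by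
  obtain ⟨r, hr, hc⟩ := exists_X_pow_mul_eq_constantCoeff_aeval_ne_zero hz hq
  have hne : aeval (algebraMap (PowerSeries k) (LaurentSeries k) z) r ≠ 0 := by
    rw [aeval_algebraMap_apply]
    exact LaurentSeries.algebraMap_ne_zero hc
  conv_lhs => rw [hr]
  rw [map_mul, map_pow, aeval_X, HahnSeries.order_mul (pow_ne_zero _ hz0) hne,
    HahnSeries.order_pow, aeval_algebraMap_apply, LaurentSeries.order_algebraMap_eq_zero hc]
  simp

/-- If `0` is a simple root of `F₁`, then the curve `F₁(x) F₂(y) = w` has a place at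
`x = 0`, `y = ∞`, with local parameter `1 / y`, which is totally ramified over `x = 0`. -/
theorem exists_totallyRamified_place {F₁ F₂ : k[X]} {n : ℕ} {w : k} (hn : 0 < n) (hw : w ≠ 0)
    (h₁ : F₁.coeff 0 = 0) (h₁' : F₁.coeff 1 ≠ 0) (h₂ : F₂.natDegree = n) :
    ∃ z : PowerSeries k, PowerSeries.constantCoeff z = 0 ∧
      (algebraMap (PowerSeries k) (LaurentSeries k) z).order = n ∧
      algebraMap (PowerSeries k) (LaurentSeries k) z ≠ 0 ∧
      aeval (algebraMap (PowerSeries k) (LaurentSeries k) z) F₁ *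
        aeval (HahnSeries.single (-1) 1 : LaurentSeries k) F₂ =
          algebraMap k (LaurentSeries k) w := by
  have hF₂ : F₂ ≠ 0 := by rintro rfl; simp at h₂; omega
  have hF₁ : F₁ ≠ 0 := by rintro rfl; simp at h₁'
  have hdeg : 0 < F₁.natDegree := lt_of_lt_of_le one_pos (le_natDegree_of_ne_zero h₁')
  set y : LaurentSeries k := HahnSeries.single (-1) 1 with hy
  -- `c = w / F₂(y)` as a power series in `1 / y`
  obtain ⟨c, hc0, hc⟩ : ∃ c : PowerSeries k, PowerSeries.constantCoeff c = 0 ∧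
      algebraMap (PowerSeries k) (LaurentSeries k) c * aeval y F₂ =
        algebraMap k (LaurentSeries k) w := by
    have hrev := constantCoeff_aeval_powerSeriesX_reverse hF₂
    refine ⟨algebraMap k (PowerSeries k) w * PowerSeries.X ^ n *
      (aeval PowerSeries.X F₂.reverse)⁻¹, by simp [hn.ne'], ?_⟩
    have hyt : algebraMap (PowerSeries k) (LaurentSeries k) PowerSeries.X * y = 1 := by
      rw [LaurentSeries.coe_algebraMap, PowerSeries.coe_X, hy]
      simp [HahnSeries.single_mul_single]
    rw [LaurentSeries.aeval_single_neg_one, h₂, ← mul_assoc, ← map_mul, mul_assoc,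
      PowerSeries.inv_mul_cancel _ hrev, mul_one, map_mul, map_pow, mul_assoc, ← mul_pow, hyt,
      one_pow, mul_one, ← IsScalarTower.algebraMap_apply]
  obtain ⟨z, hz0, hz⟩ : ∃ z : PowerSeries k, PowerSeries.constantCoeff z = 0 ∧
      aeval z F₁ = c := by
    have hlc : F₁.leadingCoeff ≠ 0 := leadingCoeff_ne_zero.2 hF₁
    let u : PowerSeries k := algebraMap k _ F₁.leadingCoeff⁻¹
    let f : (PowerSeries k)[X] := (C F₁.leadingCoeff⁻¹ * F₁).map (algebraMap k _) - C (u * c)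
    have hmonic : f.Monic := by
      refine Monic.sub_of_left ?_ ?_
      · refine Monic.map _ ?_
        rw [Monic, leadingCoeff_mul, leadingCoeff_C, inv_mul_cancel₀ hlc]
      · refine degree_C_le.trans_lt ?_
        rw [degree_map, degree_C_mul (inv_ne_zero hlc)]
        exact natDegree_pos_iff_degree_pos.1 hdeg
    have hf : ∀ z, f.eval z = u * (aeval z F₁ - c) := by
      intro z
      simp only [f, u, eval_sub, eval_map_algebraMap, eval_C, map_mul, aeval_C, eval_mul]
      ring
    have hu : u ≠ 0 := by simpa [u] using hF₁
    obtain ⟨z, hz, hz0⟩ := HenselianRing.is_henselian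
      (I := Ideal.span {(PowerSeries.X : PowerSeries k)}) f hmonic 0
      (by
        rw [hf, Ideal.mem_span_singleton, PowerSeries.X_dvd_iff, map_mul, map_sub, hc0,
          ← coeff_zero_eq_aeval_zero', h₁]
        simp)
      (by
        have : f.derivative.eval 0 = u * algebraMap k _ (F₁.coeff 1) := by
          simp only [f, u, derivative_sub, derivative_map, derivative_C, derivative_mul, eval_sub,
            eval_map_algebraMap, map_add, map_mul, aeval_C, ← coeff_zero_eq_aeval_zero',
            coeff_derivative]
          simp
        rw [this, ← map_mul]
        exact ((IsUnit.mk0 _ (mul_ne_zero (inv_ne_zero hlc) h₁')).map (algebraMap k _)).map _)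
    refine ⟨z, ?_, ?_⟩
    · rwa [sub_zero, Ideal.mem_span_singleton, PowerSeries.X_dvd_iff] at hz0
    · rw [IsRoot, hf] at hz
      exact sub_eq_zero.1 ((mul_eq_zero.1 hz).resolve_left hu)
  refine ⟨z, hz0, ?_⟩
  have hval : aeval (algebraMap (PowerSeries k) (LaurentSeries k) z) F₁ * aeval y F₂ =
      algebraMap k (LaurentSeries k) w := by
    rw [aeval_algebraMap_apply, hz, hc]
  have hwne : algebraMap k (LaurentSeries k) w ≠ 0 := by simpa using hw
  have hzne : algebraMap (PowerSeries k) (LaurentSeries k) z ≠ 0 := by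
    intro h0
    rw [h0, ← coeff_zero_eq_aeval_zero', h₁] at hval
    rw [map_zero, zero_mul] at hval
    exact hwne hval.symm
  refine ⟨?_, hzne, hval⟩
  have ho := congrArg HahnSeries.order hval
  have htr : F₁.natTrailingDegree = 1 := by
    refine le_antisymm (natTrailingDegree_le_of_ne_zero h₁') ?_
    rw [Nat.one_le_iff_ne_zero, Ne, natTrailingDegree_eq_zero]
    simp [hF₁, h₁]
  rw [HahnSeries.order_mul (left_ne_zero_of_mul (hval.trans_ne hwne))
    (right_ne_zero_of_mul (hval.trans_ne hwne)), LaurentSeries.order_aeval_single_neg_one hF₂,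
    LaurentSeries.order_aeval_algebraMap hz0 hF₁ hzne, htr, h₂] at ho
  have hwo : (algebraMap k (LaurentSeries k) w).order = 0 := by
    rw [HahnSeries.algebraMap_apply]; exact HahnSeries.order_C
  rw [hwo] at ho
  push_cast at ho
  linarith

end LaurentSeries

section Jet

variable {k R : Type*} [Field k] [CommRing R] [Algebra k R] (D : Derivation k R R)

theorem Derivation.apply_iterate_mul_of_vanish (e : R →ₐ[k] k) (m : ℕ) :
    ∀ {g h : R}, (∀ i < m, e (D^[i] h) = 0) → e (D^[m] (g * h)) = e g * e (D^[m] h) := by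
  induction m with
  | zero => intro g h _; simp
  | succ m ih =>
    intro g h hh
    rw [Function.iterate_succ_apply, D.leibniz, smul_eq_mul, smul_eq_mul, iterate_map_add,
      map_add, ih (h := D h), mul_comm h, ih (h := h) fun i hi => hh i (hi.trans m.lt_succ_self),
      hh m m.lt_succ_self, mul_zero, add_zero, ← Function.iterate_succ_apply]
    intro i hi
    rw [← Function.iterate_succ_apply]
    exact hh _ (Nat.succ_lt_succ hi)

theorem Derivation.apply_iterate_mul_eq_zero (e : R →ₐ[k] k) {m : ℕ} {g h : R}
    (hh : ∀ i < m, e (D^[i] h) = 0) {i : ℕ} (hi : i < m) : e (D^[i] (g * h)) = 0 := by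
  rw [D.apply_iterate_mul_of_vanish e i fun j hj => hh j (hj.trans hi), hh i hi, mul_zero]

theorem Derivation.apply_iterate_pow_mul (e : R →ₐ[k] k) {t : R} (ht : e t = 0) (m : ℕ) :
    ∀ g : R, (∀ i < m, e (D^[i] (t ^ m * g)) = 0) ∧
      e (D^[m] (t ^ m * g)) = m.factorial * e (D t) ^ m * e g := by
  induction m with
  | zero => intro g; simp
  | succ m ih =>
    intro g
    have key : D (t ^ (m + 1) * g) = t ^ m * ((m + 1) * D t * g + t * D g) := by
      rw [D.leibniz, D.leibniz_pow]
      simp only [smul_eq_mul, nsmul_eq_mul, add_tsub_cancel_right]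
      push_cast
      ring
    constructor
    · intro i hi
      cases i with
      | zero => simp [ht]
      | succ i =>
        rw [Function.iterate_succ_apply, key]
        exact (ih _).1 i (by omega)
    · rw [Function.iterate_succ_apply, key, (ih _).2]
      have hm : e (m : R) = m := _root_.map_natCast e m
      simp only [map_add, map_mul, ht, hm, map_one, Nat.factorial_succ]
      push_cast
      ring

/-- The first `M` derivatives along `D` at the points `e s`. -/
def Derivation.jet {S : Type*} (e : S → R →ₐ[k] k) (M : ℕ) : R →ₗ[k] (S × Fin M → k) :=
  LinearMap.pi fun a => (e a.1).toLinearMap ∘ₗ (D : R →ₗ[k] R) ^ (a.2 : ℕ)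

theorem Derivation.jet_apply {S : Type*} (e : S → R →ₐ[k] k) (M : ℕ) (h : R) (a : S × Fin M) :
    D.jet e M h a = e a.1 (D^[a.2] h) := by
  simp [Derivation.jet, Module.End.pow_apply]

theorem Derivation.jet_eq_zero_iff {S : Type*} {e : S → R →ₐ[k] k} {M : ℕ} {h : R} :
    D.jet e M h = 0 ↔ ∀ s, ∀ i < M, e s (D^[i] h) = 0 := by
  constructor
  · intro hh s i hi
    simpa [D.jet_apply] using congrFun hh (s, ⟨i, hi⟩)
  · intro hh
    ext a
    rw [D.jet_apply]
    exact hh _ _ a.2.2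

theorem Derivation.jet_mul_eq_zero {S : Type*} {e : S → R →ₐ[k] k} {M : ℕ} {h : R} (g : R)
    (hh : D.jet e M h = 0) : D.jet e M (g * h) = 0 := by
  rw [D.jet_eq_zero_iff] at hh ⊢
  exact fun s i hi => D.apply_iterate_mul_eq_zero _ (hh s) hi

theorem Derivation.jet_eq_zero_of_mul {S : Type*} {e : S → R →ₐ[k] k} {M : ℕ} {g h : R}
    (hg : ∀ s, e s g ≠ 0) (hh : D.jet e M (g * h) = 0) : D.jet e M h = 0 := by
  rw [D.jet_eq_zero_iff] at hh ⊢
  intro s i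
  induction i using Nat.strong_induction_on with
  | _ i ih =>
    intro hi
    have := hh s i hi
    rw [D.apply_iterate_mul_of_vanish _ i fun j hj => ih j hj (hj.trans hi)] at this
    exact (mul_eq_zero.1 this).resolve_left (hg s)

/-- Jets at finitely many separated points can be prescribed by elements of any subspace `U`
which contains every element of `R` up to multiplication by a function without zeros at
these points, and modulo elements with vanishing jets. -/
theorem Derivation.map_jet_eq_top {S : Type*} [Finite S] {e : S → R →ₐ[k] k} {M : ℕ}
    (hsep : ∀ s s', s ≠ s' → ∃ l, e s' l = 0 ∧ e s l ≠ 0)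
    (hpar : ∀ s, ∀ j < M, ∃ t, (∀ i < j, e s (D^[i] t) = 0) ∧ e s (D^[j] t) ≠ 0)
    {U : Submodule k R}
    (hU : ∀ h, ∃ g, (∀ s, e s g ≠ 0) ∧ ∃ u ∈ U, D.jet e M (g * h - u) = 0) :
    U.map (D.jet e M) = ⊤ := by
  have := Fintype.ofFinite S
  by_contra hne
  obtain ⟨φ, hφ, hφU⟩ := Submodule.exists_le_ker_of_lt_top _ (lt_top_iff_ne_top.2 hne)
  have hφsum : ∀ v, φ v = ∑ a, v a * φ (Pi.single a 1) := by
    intro v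
    conv_lhs => rw [pi_eq_sum_univ' v, map_sum]
    simp
  obtain ⟨a₀, ha₀⟩ : ∃ a, φ (Pi.single a 1) ≠ 0 := by
    by_contra! h0
    exact hφ (LinearMap.ext fun v => by rw [hφsum]; simp [h0])
  obtain ⟨s, j₀⟩ := a₀
  obtain ⟨j, hj, hmax⟩ := (Finset.univ.filter fun j => φ (Pi.single (s, j) 1) ≠ 0).exists_max_image
    id ⟨j₀, by simpa using ha₀⟩
  simp only [Finset.mem_filter, Finset.mem_univ, true_and, id] at hj hmax
  choose! l hl0 hl using fun s' (h : s ≠ s') => hsep s s' h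
  obtain ⟨t, ht0, ht⟩ := hpar s j j.2
  let q : R := ∏ s' ∈ Finset.univ.erase s, l s' ^ M
  have hq : e s q ≠ 0 := by
    simp only [q, map_prod, map_pow]
    exact Finset.prod_ne_zero_iff.2 fun s' hs' =>
      pow_ne_zero _ (hl s' (Finset.ne_of_mem_erase hs').symm)
  obtain ⟨g, hg, u, hu, hjet⟩ := hU (q * t)
  have hφu : φ (D.jet e M (g * (q * t))) = 0 := by
    have h1 : D.jet e M (g * (q * t)) = D.jet e M u := by
      rw [← sub_eq_zero, ← map_sub, hjet]
    rw [h1]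
    exact hφU (Submodule.mem_map_of_mem hu)
  rw [hφsum, Finset.sum_eq_single (s, j)] at hφu
  · rw [D.jet_apply, ← mul_assoc, D.apply_iterate_mul_of_vanish _ _ ht0, map_mul] at hφu
    exact mul_ne_zero (mul_ne_zero (mul_ne_zero (hg s) hq) ht) hj hφu
  · rintro ⟨s', i⟩ - hne'
    by_cases hs : s' = s
    · subst hs
      have hij : i ≠ j := fun h => hne' (by rw [h])
      by_cases hi : φ (Pi.single (s', i) 1) = 0
      · rw [hi, mul_zero]
      · have hlt : i < j := lt_of_le_of_ne (hmax i hi) hij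
        rw [D.jet_apply, ← mul_assoc, D.apply_iterate_mul_eq_zero _ ht0 hlt, zero_mul]
    · have hdvd : q = l s' ^ M * ∏ a ∈ (Finset.univ.erase s).erase s', l a ^ M :=
        (Finset.mul_prod_erase _ _ (by simp [hs])).symm
      rw [D.jet_apply, hdvd, mul_assoc, mul_left_comm,
        (D.apply_iterate_pow_mul _ (hl0 s' (Ne.symm hs)) M _).1 i i.2, zero_mul]
  · simp

end Jet

section Bivariate

variable {k : Type*} [Field k]

theorem exists_mem_monomialBox (h : MvPolynomial (Fin 2) k) :
    ∃ L d, h ∈ monomialBox k (MvPolynomial.X 0) (MvPolynomial.X 1 : MvPolynomial (Fin 2) k) L d := by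
  induction h using MvPolynomial.induction_on with
  | C a =>
    refine ⟨1, 1, ?_⟩
    rw [← MvPolynomial.algebraMap_eq, Algebra.algebraMap_eq_smul_one]
    exact Submodule.smul_mem _ _ (by
      simpa using monomial_mem_monomialBox (k := k) (x := (MvPolynomial.X 0 : MvPolynomial (Fin 2) k))
        (y := MvPolynomial.X 1) (i := 0) (j := 0) one_pos one_pos)
  | add p q hp hq =>
    obtain ⟨L, d, hp⟩ := hp
    obtain ⟨L', d', hq⟩ := hq
    exact ⟨max L L', max d d', Submodule.add_mem _
      (monomialBox_mono (le_max_left _ _) (le_max_left _ _) hp)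
      (monomialBox_mono (le_max_right _ _) (le_max_right _ _) hq)⟩
  | mul_X p i hp =>
    obtain ⟨L, d, hp⟩ := hp
    refine ⟨1 + L, 1 + d, ?_⟩
    rw [mul_comm]
    refine mul_mem_monomialBox ?_ hp
    fin_cases i
    · simpa using monomial_mem_monomialBox (k := k)
        (x := (MvPolynomial.X 0 : MvPolynomial (Fin 2) k)) (y := MvPolynomial.X 1)
        (i := 1) (j := 0) (L := 2) (d := 2) (by omega) (by omega)
    · simpa using monomial_mem_monomialBox (k := k)
        (x := (MvPolynomial.X 0 : MvPolynomial (Fin 2) k)) (y := MvPolynomial.X 1)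
        (i := 0) (j := 1) (L := 2) (d := 2) (by omega) (by omega)

/-- The polynomial `F₁(x) F₂(y) - w`. -/
def productCurve (F₁ F₂ : k[X]) (w : k) : MvPolynomial (Fin 2) k :=
  aeval (MvPolynomial.X 0) F₁ * aeval (MvPolynomial.X 1) F₂ - algebraMap k _ w

variable {F₁ F₂ : k[X]} {n : ℕ} {w : k}

theorem aeval_productCurve {E : Type*} [CommRing E] [Algebra k E] (x y : E) :
    MvPolynomial.aeval ![x, y] (productCurve F₁ F₂ w) =
      aeval x F₁ * aeval y F₂ - algebraMap k E w := by
  simp [productCurve, ← aeval_algHom_apply]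

theorem exists_pow_mul_sub_eq_mul_productCurve (hn : 0 < n) (h₁ : F₁.natDegree ≤ n)
    (h₂ : F₂.natDegree = n) {L m : ℕ} {h : MvPolynomial (Fin 2) k}
    (hh : h ∈ monomialBox k (MvPolynomial.X 0) (MvPolynomial.X 1) L (n + m)) :
    ∃ u ∈ monomialBox k (MvPolynomial.X 0) (MvPolynomial.X 1 : MvPolynomial (Fin 2) k)
      (L + n * m) n, ∃ c, aeval (MvPolynomial.X 0) F₁ ^ m * h - u = c * productCurve F₁ F₂ w := by
  let I := Ideal.span {productCurve F₁ F₂ w}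
  let π := Ideal.Quotient.mkₐ k I
  have hxy : aeval (π (MvPolynomial.X 0)) F₁ * aeval (π (MvPolynomial.X 1)) F₂ =
      algebraMap k _ w := by
    rw [aeval_algHom_apply, aeval_algHom_apply, ← map_mul, ← π.commutes, ← sub_eq_zero, ← map_sub]
    exact Ideal.Quotient.eq_zero_iff_mem.2 (Ideal.mem_span_singleton_self _)
  have := pow_mul_mem_monomialBox hn h₁ h₂ hxy m (map_mem_monomialBox π hh)
  rw [← map_monomialBox] at this
  obtain ⟨u, hu, hπ⟩ := this
  refine ⟨u, hu, ?_⟩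
  have hmem : aeval (MvPolynomial.X 0) F₁ ^ m * h - u ∈ I := by
    rw [← Ideal.Quotient.eq_zero_iff_mem]
    change π _ = 0
    rw [map_sub, map_mul, map_pow, ← aeval_algHom_apply, sub_eq_zero]
    exact hπ.symm
  obtain ⟨c, hc⟩ := Ideal.mem_span_singleton'.1 hmem
  exact ⟨c, hc.symm⟩

variable {x y : LaurentSeries k}

theorem order_monomial (hx0 : x ≠ 0) (hy0 : y ≠ 0) (hx : x.order = n) (hy : y.order = -1)
    (i j : ℕ) : (x ^ i * y ^ j).order = n * i - j := by
  rw [HahnSeries.order_mul (pow_ne_zero _ hx0) (pow_ne_zero _ hy0), HahnSeries.order_pow,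
    HahnSeries.order_pow, hx, hy]
  simp only [nsmul_eq_mul]
  ring

theorem eq_and_eq_of_mul_sub_eq {i j i' j' : ℕ} (hj : j < n) (hj' : j' < n)
    (h : (n * i - j : ℤ) = n * i' - j') : i = i' ∧ j = j' := by
  have h1 : (n : ℤ) * (i - i') = j - j' := by linarith
  have h2 : (i : ℤ) - i' = 0 := by
    by_contra hne
    have h3 : (n : ℤ) ≤ |(j : ℤ) - j'| := by
      rw [← h1, abs_mul, Nat.abs_cast]
      have := Int.one_le_abs hne
      nlinarith [Int.natCast_nonneg n]
    rcases abs_cases ((j : ℤ) - j') with h | h <;> omega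
  rw [h2] at h1
  omega

theorem linearIndependent_monomials (hx0 : x ≠ 0) (hy0 : y ≠ 0) (hx : x.order = n)
    (hy : y.order = -1) (L : ℕ) :
    LinearIndependent k fun a : Fin L × Fin n => x ^ (a.1 : ℕ) * y ^ (a.2 : ℕ) := by
  refine HahnSeries.linearIndependent_of_injective_order
    (fun a => mul_ne_zero (pow_ne_zero _ hx0) (pow_ne_zero _ hy0)) fun a b hab => ?_
  simp only [order_monomial hx0 hy0 hx hy] at hab
  obtain ⟨h1, h2⟩ := eq_and_eq_of_mul_sub_eq a.2.2 b.2.2 hab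
  exact Prod.ext (Fin.ext h1) (Fin.ext h2)

/-- A function on the curve `F₁(x) F₂(y) = w` which does not vanish identically has few zeros,
counted with multiplicity: this bounds the number of points at which it vanishes to order `M`. -/
theorem mul_card_le_of_jet_eq_zero {S : Type*} [Fintype S] {a b : S → k} {M DX DY : ℕ}
    (hn : 0 < n) (hw : w ≠ 0) (h₁ : F₁.natDegree ≤ n) (h₂ : F₂.natDegree = n)
    (hx0 : x ≠ 0) (hy0 : y ≠ 0) (hx : x.order = n) (hy : y.order = -1)
    (hxy : aeval x F₁ * aeval y F₂ = algebraMap k _ w)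
    (hab : Function.Injective fun s => (a s, b s))
    (hcurve : ∀ s, F₁.eval (a s) * F₂.eval (b s) = w)
    (D : Derivation k (MvPolynomial (Fin 2) k) (MvPolynomial (Fin 2) k))
    (hD : D.jet (fun s => MvPolynomial.aeval ![a s, b s]) M (productCurve F₁ F₂ w) = 0)
    (hpar : ∀ s, ∀ j < M, ∃ t, (∀ i < j, MvPolynomial.aeval ![a s, b s] (D^[i] t) = 0) ∧
      MvPolynomial.aeval ![a s, b s] (D^[j] t) ≠ 0)
    {P : MvPolynomial (Fin 2) k}
    (hP : P ∈ monomialBox k (MvPolynomial.X 0) (MvPolynomial.X 1) (DX + 1) (DY + 1))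
    (hP0 : MvPolynomial.aeval ![x, y] P ≠ 0)
    (hPjet : D.jet (fun s => MvPolynomial.aeval ![a s, b s]) M P = 0) :
    Fintype.card S * M ≤ (DX + n * DY) * n := by
  set e : S → MvPolynomial (Fin 2) k →ₐ[k] k := fun s => MvPolynomial.aeval ![a s, b s] with he
  set φ : MvPolynomial (Fin 2) k →ₐ[k] LaurentSeries k := MvPolynomial.aeval ![x, y] with hφ
  let B : ℕ → Submodule k (MvPolynomial (Fin 2) k) := fun L =>
    monomialBox k (MvPolynomial.X 0) (MvPolynomial.X 1) L n
  have hφX : φ (MvPolynomial.X 0) = x := by simp [hφ]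
  have hφY : φ (MvPolynomial.X 1) = y := by simp [hφ]
  have hφB : ∀ L, (B L).map φ.toLinearMap = monomialBox k x y L n := fun L => by
    rw [map_monomialBox, hφX, hφY]
  have hindep := linearIndependent_monomials hx0 hy0 hx hy
  have hindepR : ∀ L, LinearIndependent k fun a : Fin L × Fin n =>
      (MvPolynomial.X 0 : MvPolynomial (Fin 2) k) ^ (a.1 : ℕ) * MvPolynomial.X 1 ^ (a.2 : ℕ) := by
    intro L
    refine LinearIndependent.of_comp φ.toLinearMap ?_
    have hcomp : (fun a : Fin L × Fin n => x ^ (a.1 : ℕ) * y ^ (a.2 : ℕ)) =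
        φ.toLinearMap ∘ fun a : Fin L × Fin n =>
          MvPolynomial.X 0 ^ (a.1 : ℕ) * MvPolynomial.X 1 ^ (a.2 : ℕ) := by
      funext a
      simp [hφX, hφY]
    rw [← hcomp]
    exact hindep L
  have hBrank : ∀ L, Module.finrank k (B L) = L * n := fun L => finrank_monomialBox (hindepR L)
  have hφinj : ∀ L, ∀ u ∈ B L, φ u = 0 → u = 0 := by
    intro L u hu hφu
    have hr : Module.finrank k ((B L).map φ.toLinearMap) = Module.finrank k (B L) := by
      rw [hφB, hBrank, finrank_monomialBox (hindep L)]
    have hker := (φ.toLinearMap.domRestrict (B L)).finrank_range_add_finrank_ker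
    rw [LinearMap.range_domRestrict, hr] at hker
    have hbot := Submodule.finrank_eq_zero.1 (Nat.add_eq_left.1 hker)
    have : (⟨u, hu⟩ : B L) ∈ (φ.toLinearMap.domRestrict (B L)).ker := by simpa using hφu
    rw [hbot, Submodule.mem_bot] at this
    exact congrArg Subtype.val this
  have hF₁e : ∀ m s, e s (aeval (MvPolynomial.X 0) F₁ ^ m) ≠ 0 := by
    intro m s
    rw [map_pow, ← aeval_algHom_apply]
    refine pow_ne_zero _ ?_
    have : F₁.eval (a s) ≠ 0 := left_ne_zero_of_mul ((hcurve s).trans_ne hw)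
    simpa [he, ← coe_aeval_eq_eval] using this
  have hred : ∀ h, ∃ m L, ∃ u ∈ B L, ∃ c,
      aeval (MvPolynomial.X 0) F₁ ^ m * h - u = c * productCurve F₁ F₂ w := by
    intro h
    obtain ⟨L, d, hh⟩ := exists_mem_monomialBox h
    exact ⟨d, _, exists_pow_mul_sub_eq_mul_productCurve hn h₁ h₂
      (monomialBox_mono le_rfl (Nat.le_add_left d n) hh)⟩
  have hφcurve : φ (productCurve F₁ F₂ w) = 0 := by
    rw [hφ, aeval_productCurve, hxy, sub_self]
  have hjet0 : ∀ h, φ h = 0 → D.jet e M h = 0 := by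
    intro h hh
    obtain ⟨m, L, u, hu, c, hc⟩ := hred h
    have hu0 : u = 0 := by
      refine hφinj L u hu ?_
      have := congrArg φ hc
      rwa [map_sub, map_mul, map_mul, hφcurve, hh, mul_zero, mul_zero, zero_sub,
        neg_eq_zero] at this
    rw [hu0, sub_zero] at hc
    refine D.jet_eq_zero_of_mul (hF₁e m) ?_
    rw [hc]
    exact D.jet_mul_eq_zero c hD
  have hmono : Monotone B := fun L L' h => monomialBox_mono h le_rfl
  obtain ⟨N, hN⟩ : ∃ N, (B N).map (D.jet e M) = ⊤ := by
    have htop : (⨆ L, B L).map (D.jet e M) = ⊤ := by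
      refine D.map_jet_eq_top ?_ hpar ?_
      · intro s s' hss
        by_cases has : a s = a s'
        · have hbs : b s ≠ b s' := fun h => hss (hab (Prod.ext has h))
          refine ⟨MvPolynomial.X 1 - MvPolynomial.C (b s'), ?_, ?_⟩
          · simp
          · simpa [he, sub_eq_zero] using hbs
        · refine ⟨MvPolynomial.X 0 - MvPolynomial.C (a s'), ?_, ?_⟩
          · simp
          · simpa [he, sub_eq_zero] using has
      · intro h
        obtain ⟨m, L, u, hu, c, hc⟩ := hred h
        refine ⟨_, hF₁e m, u, le_iSup B L hu, ?_⟩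
        rw [hc]
        exact D.jet_mul_eq_zero c hD
    obtain ⟨N, hN⟩ := monotone_stabilizes_iff_noetherian.2
      (inferInstance : IsNoetherian k (S × Fin M → k))
      ⟨fun L => (B L).map (D.jet e M), fun L L' h => Submodule.map_mono (hmono h)⟩
    refine ⟨N, ?_⟩
    rw [← htop, Submodule.map_iSup]
    refine le_antisymm (le_iSup (fun L => (B L).map (D.jet e M)) N) (iSup_le fun L => ?_)
    rcases le_total L N with h | h
    · exact Submodule.map_mono (hmono h)
    · exact (hN L h).ge
  -- compare `B L` with its subspace of elements with vanishing jets
  let L := DX + N + n * DY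
  have hL : (B L).map (D.jet e M) = ⊤ :=
    top_le_iff.1 (hN ▸ Submodule.map_mono (hmono (by omega)))
  have hrank := ((D.jet e M).domRestrict (B L)).finrank_range_add_finrank_ker
  rw [LinearMap.range_domRestrict, hL, finrank_top, Module.finrank_fintype_fun_eq_card, hBrank,
    Fintype.card_prod, Fintype.card_fin] at hrank
  have hker : N * n ≤ Module.finrank k ((D.jet e M).domRestrict (B L)).ker := by
    let g := aeval x F₁ ^ DY * φ P
    have hg : g ≠ 0 := by
      refine mul_ne_zero (pow_ne_zero _ (left_ne_zero_of_mul (hxy.trans_ne ?_))) hP0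
      simpa using hw
    let ψ : ((D.jet e M).domRestrict (B L)).ker →ₗ[k] LaurentSeries k :=
      φ.toLinearMap ∘ₗ (B L).subtype ∘ₗ Submodule.subtype _
    have hle : (monomialBox k x y N n).map (LinearMap.mulLeft k g) ≤ ψ.range := by
      rw [← hφB]
      rintro _ ⟨_, ⟨q, hq, rfl⟩, rfl⟩
      have hPq := mul_mem_monomialBox hP hq
      have := pow_mul_mem_monomialBox hn h₁ h₂ hxy DY
        (by rw [← hφX, ← hφY]; exact map_mem_monomialBox φ (add_comm DY n ▸ hPq))
      rw [← hφB] at this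
      obtain ⟨u, hu, huφ⟩ := this
      refine ⟨⟨⟨u, hu⟩, ?_⟩, ?_⟩
      · have h0 : D.jet e M (u - aeval (MvPolynomial.X 0) F₁ ^ DY * (P * q)) = 0 := by
          refine hjet0 _ ?_
          rw [map_sub, map_mul, map_pow, ← aeval_algHom_apply, hφX, sub_eq_zero]
          exact huφ
        have h1 : D.jet e M (aeval (MvPolynomial.X 0) F₁ ^ DY * (P * q)) = 0 := by
          rw [mul_comm P, ← mul_assoc]
          exact D.jet_mul_eq_zero _ hPjet
        rw [map_sub, h1, sub_zero] at h0
        simpa using h0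
      · change φ u = g * φ q
        rw [show φ u = _ from huφ, map_mul]
        ring
    calc N * n = Module.finrank k (monomialBox k x y N n) := (finrank_monomialBox (hindep N)).symm
      _ = Module.finrank k ((monomialBox k x y N n).map (LinearMap.mulLeft k g)) := by
        exact (Submodule.equivMapOfInjective _ (mul_right_injective₀ hg) _).finrank_eq
      _ ≤ Module.finrank k ψ.range := Submodule.finrank_mono hle
      _ ≤ _ := LinearMap.finrank_range_le ψ
  have hexp : L * n = N * n + (DX + n * DY) * n := by simp only [L]; ring
  omega

end Bivariate

section AuxiliaryPolynomial

variable {k : Type*} [Field k]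

theorem exists_ne_zero_forall_sum_smul_eq_zero {E ι κ : Type*} [AddCommGroup E] [Module k E]
    [Fintype ι] [Fintype κ] (W : κ → Submodule k E) [∀ j, Module.Finite k (W j)]
    {v : κ → ι → E} (hv : ∀ j i, v j i ∈ W j)
    (h : ∑ j, Module.finrank k (W j) < Fintype.card ι) :
    ∃ c : ι → k, c ≠ 0 ∧ ∀ j, ∑ i, c i • v j i = 0 := by
  let f : (ι → k) →ₗ[k] ∀ j, W j := LinearMap.pi fun j =>
    Fintype.linearCombination k fun i => (⟨v j i, hv j i⟩ : W j)
  have hker : f.ker ≠ ⊥ := by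
    refine LinearMap.ker_ne_bot_of_finrank_lt ?_
    rwa [Module.finrank_pi_fintype, Module.finrank_fintype_fun_eq_card]
  obtain ⟨c, hc, hc0⟩ := Submodule.exists_mem_ne_zero_of_ne_bot hker
  refine ⟨c, hc0, fun j => ?_⟩
  have := congrArg Subtype.val (congrFun (LinearMap.mem_ker.1 hc) j)
  simpa [f, Fintype.linearCombination_apply] using this

/-- The derivation of `k[X, Y]` tangent to the curves `F₁(X) F₂(Y) = w`. -/
def tangentDerivation (F₁ F₂ : k[X]) :
    Derivation k (MvPolynomial (Fin 2) k) (MvPolynomial (Fin 2) k) :=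
  MvPolynomial.mkDerivation k
    ![aeval (MvPolynomial.X 0) F₁ * aeval (MvPolynomial.X 1) (derivative F₂),
      -(aeval (MvPolynomial.X 0) (derivative F₁) * aeval (MvPolynomial.X 1) F₂)]

variable {F₁ F₂ : k[X]} {n : ℕ}

theorem tangentDerivation_X_zero : tangentDerivation F₁ F₂ (MvPolynomial.X 0) =
    aeval (MvPolynomial.X 0) F₁ * aeval (MvPolynomial.X 1) (derivative F₂) := by
  simp [tangentDerivation, MvPolynomial.mkDerivation_X]

theorem tangentDerivation_X_one : tangentDerivation F₁ F₂ (MvPolynomial.X 1) =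
    -(aeval (MvPolynomial.X 0) (derivative F₁) * aeval (MvPolynomial.X 1) F₂) := by
  simp [tangentDerivation, MvPolynomial.mkDerivation_X]

theorem tangentDerivation_productCurve (w : k) :
    tangentDerivation F₁ F₂ (productCurve F₁ F₂ w) = 0 := by
  rw [productCurve, map_sub, Derivation.map_algebraMap, Derivation.leibniz, Derivation.map_aeval,
    Derivation.map_aeval, tangentDerivation_X_zero, tangentDerivation_X_one]
  simp only [smul_eq_mul]
  ring

theorem tangentDerivation_mem_monomialBox (h₁ : F₁.natDegree ≤ n) (h₂ : F₂.natDegree ≤ n)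
    {L m : ℕ} {h : MvPolynomial (Fin 2) k}
    (hh : h ∈ monomialBox k (MvPolynomial.X 0) (MvPolynomial.X 1) L m) :
    tangentDerivation F₁ F₂ h ∈
      monomialBox k (MvPolynomial.X 0) (MvPolynomial.X 1) (n + L) (n + m) := by
  have hprod : ∀ {p q : k[X]}, p.natDegree ≤ n → q.natDegree ≤ n →
      aeval (MvPolynomial.X 0) p * aeval (MvPolynomial.X 1) q ∈
        monomialBox k (MvPolynomial.X 0) (MvPolynomial.X 1 : MvPolynomial (Fin 2) k)
          (n + 1) (n + 1) := by
    intro p q hp hq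
    have := mul_mem_monomialBox (a := n) (b := 0)
      (aeval_left_mem_monomialBox (x := (MvPolynomial.X 0 : MvPolynomial (Fin 2) k))
        (y := MvPolynomial.X 1) hp) (aeval_right_mem_monomialBox hq)
    rwa [zero_add] at this
  have hX : tangentDerivation F₁ F₂ (MvPolynomial.X 0) ∈ monomialBox k (MvPolynomial.X 0)
      (MvPolynomial.X 1) (n + 1) (n + 1) :=
    tangentDerivation_X_zero (F₁ := F₁) (F₂ := F₂) ▸
      hprod h₁ ((natDegree_derivative_le _).trans (by omega))
  have hY : tangentDerivation F₁ F₂ (MvPolynomial.X 1) ∈ monomialBox k (MvPolynomial.X 0)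
      (MvPolynomial.X 1) (n + 1) (n + 1) :=
    tangentDerivation_X_one (F₁ := F₁) (F₂ := F₂) ▸ Submodule.neg_mem _
      (hprod ((natDegree_derivative_le _).trans (by omega)) h₂)
  have hle : monomialBox k (MvPolynomial.X 0) (MvPolynomial.X 1) L m ≤
      (monomialBox k (MvPolynomial.X 0) (MvPolynomial.X 1) (n + L) (n + m)).comap
        (tangentDerivation F₁ F₂ : MvPolynomial (Fin 2) k →ₗ[k] MvPolynomial (Fin 2) k) := by
    refine monomialBox_le fun i hi j hj => ?_
    rw [Submodule.mem_comap, Derivation.coeFn_coe]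
    rw [Derivation.leibniz, Derivation.leibniz_pow, Derivation.leibniz_pow]
    refine Submodule.add_mem _ ?_ ?_
    · have : (MvPolynomial.X 0 ^ i : MvPolynomial (Fin 2) k) • j • (MvPolynomial.X 1 ^ (j - 1) : MvPolynomial (Fin 2) k) •
          tangentDerivation F₁ F₂ (MvPolynomial.X 1) =
          j • (tangentDerivation F₁ F₂ (MvPolynomial.X 1) *
            (MvPolynomial.X 0 ^ i * MvPolynomial.X 1 ^ (j - 1))) := by
        simp only [smul_eq_mul, nsmul_eq_mul]
        ring
      rw [this]
      exact nsmul_mem (mul_mem_monomialBox hY (monomial_mem_monomialBox hi (by omega))) _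
    · have : (MvPolynomial.X 1 ^ j : MvPolynomial (Fin 2) k) • i • (MvPolynomial.X 0 ^ (i - 1) : MvPolynomial (Fin 2) k) •
          tangentDerivation F₁ F₂ (MvPolynomial.X 0) =
          i • (tangentDerivation F₁ F₂ (MvPolynomial.X 0) *
            (MvPolynomial.X 0 ^ (i - 1) * MvPolynomial.X 1 ^ j)) := by
        simp only [smul_eq_mul, nsmul_eq_mul]
        ring
      rw [this]
      exact nsmul_mem (mul_mem_monomialBox hX (monomial_mem_monomialBox (by omega) hj)) _
  exact hle hh

theorem iterate_tangentDerivation_mem_monomialBox (h₁ : F₁.natDegree ≤ n)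
    (h₂ : F₂.natDegree ≤ n) (m : ℕ) {L d : ℕ} {h : MvPolynomial (Fin 2) k}
    (hh : h ∈ monomialBox k (MvPolynomial.X 0) (MvPolynomial.X 1) L d) :
    (tangentDerivation F₁ F₂)^[m] h ∈
      monomialBox k (MvPolynomial.X 0) (MvPolynomial.X 1) (m * n + L) (m * n + d) := by
  induction m with
  | zero => simpa using hh
  | succ m ih =>
    rw [Function.iterate_succ_apply']
    have := tangentDerivation_mem_monomialBox h₁ h₂ ih
    convert this using 2 <;> ring

theorem Derivation.map_pow_mul_char {R : Type*} [CommRing R] [Algebra k R] (p : ℕ) [CharP k p]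
    (D : Derivation k R R) (i : ℕ) (t : R) : D (t ^ (p * i)) = 0 := by
  rw [D.leibniz_pow, ← Nat.cast_smul_eq_nsmul k, Nat.cast_mul, CharP.cast_eq_zero, zero_mul,
    zero_smul]

theorem Derivation.iterate_mul_of_apply_eq_zero {R : Type*} [CommRing R] [Algebra k R]
    (D : Derivation k R R) {c : R} (hc : D c = 0) (m : ℕ) (g : R) :
    D^[m] (c * g) = c * D^[m] g := by
  induction m with
  | zero => rfl
  | succ m ih =>
    rw [Function.iterate_succ_apply', ih, D.leibniz, hc, smul_zero, add_zero, smul_eq_mul,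
      Function.iterate_succ_apply' D m g]

variable {w : k} {x y : LaurentSeries k} {S : Type*} [Fintype S] {a b : S → k} {p M A B : ℕ}

theorem linearIndependent_monomials_add_mul (hn : 0 < n) (hx0 : x ≠ 0) (hy0 : y ≠ 0)
    (hx : x.order = n) (hy : y.order = -1) (hA : n * A ≤ p) :
    LinearIndependent k fun i : (Fin A × Fin n) × (Fin B × Fin n) =>
      x ^ (i.1.1 + p * i.2.1 : ℕ) * y ^ (i.1.2 + p * i.2.2 : ℕ) := by
  refine HahnSeries.linearIndependent_of_injective_order
    (fun a => mul_ne_zero (pow_ne_zero _ hx0) (pow_ne_zero _ hy0)) ?_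
  rintro ⟨⟨i₁, j₁⟩, i₁', j₁'⟩ ⟨⟨i₂, j₂⟩, i₂', j₂'⟩ h
  simp only [order_monomial hx0 hy0 hx hy] at h
  push_cast at h
  have hdiff : (p : ℤ) * ((n * i₁' - j₁' : ℤ) - (n * i₂' - j₂')) =
      (n * i₂ - j₂) - (n * i₁ - j₁) := by linarith
  have hA' : (n : ℤ) * A ≤ p := by exact_mod_cast hA
  have hi₁ : (n : ℤ) * i₁ ≤ n * (A - 1) := by
    have : (i₁ : ℤ) ≤ A - 1 := by have := i₁.2; omega
    exact mul_le_mul_of_nonneg_left this (by positivity)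
  have hi₂ : (n : ℤ) * i₂ ≤ n * (A - 1) := by
    have : (i₂ : ℤ) ≤ A - 1 := by have := i₂.2; omega
    exact mul_le_mul_of_nonneg_left this (by positivity)
  have h0₁ : (0 : ℤ) ≤ n * i₁ := by positivity
  have h0₂ : (0 : ℤ) ≤ n * i₂ := by positivity
  have hj₁ := j₁.2
  have hj₂ := j₂.2
  have hzero : (n * i₁' - j₁' : ℤ) - (n * i₂' - j₂') = 0 := by
    by_contra hne
    have h1 := Int.one_le_abs hne
    have h2 : (p : ℤ) ≤ |(n * i₂ - j₂ : ℤ) - (n * i₁ - j₁)| := by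
      rw [← hdiff, abs_mul, Nat.abs_cast]
      nlinarith [Int.natCast_nonneg p]
    have h3 : |(n * i₂ - j₂ : ℤ) - (n * i₁ - j₁)| < p := by
      rw [abs_lt]
      constructor <;> nlinarith
    omega
  rw [hzero, mul_zero] at hdiff
  obtain ⟨e1, e2⟩ := eq_and_eq_of_mul_sub_eq j₁.2 j₂.2 (by linarith : (n * i₁ - j₁ : ℤ) = n * i₂ - j₂)
  obtain ⟨e3, e4⟩ := eq_and_eq_of_mul_sub_eq j₁'.2 j₂'.2
    (by linarith : (n * i₁' - j₁' : ℤ) = n * i₂' - j₂')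
  ext <;> assumption

set_option maxHeartbeats 400000 in
/-- Stepanov's bound for the points of `F₁(x) F₂(y) = w` on which the `p`-th power map is given
by a translation in each coordinate. -/
theorem mul_card_le_of_pow_char_eq [CharP k p] (hp : p.Prime)
    (hn : 0 < n) (hw : w ≠ 0) (h₁ : F₁.natDegree ≤ n) (h₂ : F₂.natDegree = n)
    (h₁0 : F₁.coeff 0 = 0) (h₁1 : F₁.coeff 1 ≠ 0) {δ : k}
    (hab : Function.Injective fun s => (a s, b s))
    (hcurve : ∀ s, F₁.eval (a s) * F₂.eval (b s) = w)
    (hsep : ∀ s, (derivative F₂).eval (b s) ≠ 0)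
    (ha : ∀ s, a s ^ p = a s + δ) (hb : ∀ s, b s ^ p = b s)
    (hM : M ≤ p) (hA : n * A ≤ p)
    (hcount : ∑ m ∈ Finset.range M, (A + B + m * n + n * (n + m * n)) * n < A * n * (B * n)) :
    Fintype.card S * M ≤ (A + p * B + n * (n + p * n)) * n := by
  obtain ⟨z, hz0, hz, hzne, hxy⟩ := exists_totallyRamified_place hn hw h₁0 h₁1 h₂
  set x : LaurentSeries k := algebraMap (PowerSeries k) (LaurentSeries k) z
  set y : LaurentSeries k := HahnSeries.single (-1) 1
  have hy0 : y ≠ 0 := HahnSeries.single_ne_zero one_ne_zero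
  have hy : y.order = -1 := HahnSeries.order_single one_ne_zero
  set D := tangentDerivation F₁ F₂ with hD
  let e : S → MvPolynomial (Fin 2) k →ₐ[k] k := fun s => MvPolynomial.aeval ![a s, b s]
  have hF₁ : ∀ s, F₁.eval (a s) ≠ 0 := fun s => left_ne_zero_of_mul ((hcurve s).trans_ne hw)
  let ι := (Fin A × Fin n) × (Fin B × Fin n)
  let mon : ι → MvPolynomial (Fin 2) k := fun i =>
    MvPolynomial.X 0 ^ (i.1.1 + p * i.2.1 : ℕ) * MvPolynomial.X 1 ^ (i.1.2 + p * i.2.2 : ℕ)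
  have hmonD : ∀ (i : ι) m, D^[m] (mon i) = MvPolynomial.X 0 ^ (p * i.2.1 : ℕ) *
      MvPolynomial.X 1 ^ (p * i.2.2 : ℕ) *
      D^[m] (MvPolynomial.X 0 ^ (i.1.1 : ℕ) * MvPolynomial.X 1 ^ (i.1.2 : ℕ)) := by
    intro i m
    rw [← D.iterate_mul_of_apply_eq_zero]
    · congr 1
      simp only [mon]
      ring
    · rw [D.leibniz, D.map_pow_mul_char p, D.map_pow_mul_char p, smul_zero, smul_zero, add_zero]
  have hcurveE : aeval a F₁ * aeval b F₂ = algebraMap k (S → k) w := by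
    ext s
    have h1 := aeval_algHom_apply (Pi.evalAlgHom k (fun _ : S => k) s) a F₁
    have h2 := aeval_algHom_apply (Pi.evalAlgHom k (fun _ : S => k) s) b F₂
    simp only [Pi.evalAlgHom_apply, coe_aeval_eq_eval] at h1 h2
    rw [Pi.mul_apply, ← h1, ← h2, hcurve]
    rfl
  let W : Fin M → Submodule k (S → k) := fun m =>
    monomialBox k a b (A + B + m * n + n * (n + m * n)) n
  let v : Fin M → ι → (S → k) := fun m i => aeval a F₁ ^ (n + m * n : ℕ) *
    fun s => e s (D^[m] (mon i))
  have hv : ∀ m i, v m i ∈ W m := by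
    intro m i
    refine pow_mul_mem_monomialBox hn h₁ h₂ hcurveE _ ?_
    have h1 := iterate_tangentDerivation_mem_monomialBox h₁ h₂.le m
      (monomial_mem_monomialBox (k := k) (x := (MvPolynomial.X 0 : MvPolynomial (Fin 2) k))
        (y := MvPolynomial.X 1) i.1.1.2 i.1.2.2)
    have h2 := map_mem_monomialBox (MvPolynomial.aeval ![a, b] :
      MvPolynomial (Fin 2) k →ₐ[k] (S → k)) h1
    simp only [MvPolynomial.aeval_X, Matrix.cons_val_zero, Matrix.cons_val_one] at h2
    have h3 : aeval a ((X + C δ) ^ (i.2.1 : ℕ)) ∈ monomialBox k a b (B - 1 + 1) 1 := by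
      refine aeval_left_mem_monomialBox ((natDegree_pow_le).trans ?_)
      rw [natDegree_X_add_C]
      have := i.2.1.2
      omega
    have h4 : a ^ 0 * b ^ (i.2.2 : ℕ) ∈ monomialBox k a b (0 + 1) (n - 1 + 1) :=
      monomial_mem_monomialBox zero_lt_one (by have := i.2.2.2; omega)
    have h5 := mul_mem_monomialBox (b := 0) h3 (mul_mem_monomialBox h4 h2)
    refine monomialBox_mono (by omega) (by omega) ?_
      (L := B - 1 + (0 + (m * n + A))) (d := 0 + (n - 1 + (m * n + n)))
    convert h5 using 1
    ext s
    have hev : ∀ q : MvPolynomial (Fin 2) k, (MvPolynomial.aeval ![a, b] q : S → k) s = e s q := by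
      intro q
      have : (Pi.evalAlgHom k (fun _ : S => k) s).comp (MvPolynomial.aeval ![a, b]) = e s := by
        refine MvPolynomial.algHom_ext fun i => ?_
        fin_cases i <;> simp [e]
      exact DFunLike.congr_fun this q
    rw [hmonD]
    simp only [Pi.mul_apply, map_mul, map_pow, hev, aeval_X, map_add, aeval_C, Pi.pow_apply,
      Pi.add_apply, pow_zero, one_mul, hD]
    have e0 : e s (MvPolynomial.X 0) = a s := by simp [e]
    have e1 : e s (MvPolynomial.X 1) = b s := by simp [e]
    rw [e0, e1, pow_mul, pow_mul, ha, hb, mul_assoc]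
    rfl
  obtain ⟨c, hc0, hc⟩ := exists_ne_zero_forall_sum_smul_eq_zero W hv (by
    refine lt_of_le_of_lt (Finset.sum_le_sum fun m _ => finrank_monomialBox_le) ?_
    rw [Fin.sum_univ_eq_sum_range fun m => (A + B + m * n + n * (n + m * n)) * n]
    simpa [ι] using hcount)
  have hn' := hn
  rcases Nat.eq_zero_or_pos B with rfl | hB
  · simp at hcount
  refine le_trans (mul_card_le_of_jet_eq_zero (DX := A + p * (B - 1)) (DY := n + p * (n - 1))
    hn hw h₁ h₂ hzne hy0 hz hy hxy hab hcurve D ?_ ?_ (P := ∑ i, c i • mon i) ?_ ?_ ?_) ?_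
  · rw [D.jet_eq_zero_iff]
    intro s m _
    cases m with
    | zero =>
      rw [Function.iterate_zero, id, aeval_productCurve]
      simp [coe_aeval_eq_eval, hcurve]
    | succ m =>
      rw [Function.iterate_succ_apply, hD, tangentDerivation_productCurve,
        iterate_map_zero, map_zero]
  · intro s j hj
    have ht : e s (MvPolynomial.X 0 - MvPolynomial.C (a s)) = 0 := by simp [e]
    obtain ⟨t1, t2⟩ := D.apply_iterate_pow_mul (e s) ht j 1
    refine ⟨_, t1, ?_⟩
    rw [t2, map_one, mul_one]
    refine mul_ne_zero ?_ (pow_ne_zero _ ?_)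
    · rw [Ne, CharP.cast_eq_zero_iff k p, hp.dvd_factorial]
      omega
    · rw [map_sub, ← MvPolynomial.algebraMap_eq, D.map_algebraMap, sub_zero, hD,
        tangentDerivation_X_zero, map_mul, ← aeval_algHom_apply, ← aeval_algHom_apply]
      simpa [e, coe_aeval_eq_eval] using ⟨hF₁ s, hsep s⟩
  · refine Submodule.sum_mem _ fun i _ => Submodule.smul_mem _ _
      (monomial_mem_monomialBox ?_ ?_)
    · have h1 := i.1.1.2
      have h2 : p * i.2.1 ≤ p * (B - 1) := Nat.mul_le_mul_left _ (by have := i.2.1.2; omega)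
      omega
    · have h1 := i.1.2.2
      have h2 : p * i.2.2 ≤ p * (n - 1) := Nat.mul_le_mul_left _ (by have := i.2.2.2; omega)
      omega
  · intro h0
    have hli := linearIndependent_monomials_add_mul (B := B) hn hzne hy0 hz hy hA
    refine hc0 (funext (Fintype.linearIndependent_iff.1 hli c (Eq.trans ?_ h0)))
    rw [map_sum]
    refine Finset.sum_congr rfl fun i _ => ?_
    rw [map_smul, map_mul, map_pow, map_pow, MvPolynomial.aeval_X, MvPolynomial.aeval_X]
    rfl
  · rw [D.jet_eq_zero_iff]
    intro s m hm
    have h1 := congrFun (hc ⟨m, hm⟩) s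
    have h2 : (aeval a F₁ : S → k) s ≠ 0 := by
      have := aeval_algHom_apply (Pi.evalAlgHom k (fun _ : S => k) s) a F₁
      simp only [Pi.evalAlgHom_apply, coe_aeval_eq_eval] at this
      rw [← this]
      exact hF₁ s
    have h3 : (aeval a F₁ : S → k) s ^ (n + m * n : ℕ) * e s (D^[m] (∑ i, c i • mon i)) = 0 := by
      have hlin : D^[m] (∑ i, c i • mon i) = ∑ i, c i • D^[m] (mon i) := by
        have : ∀ q, D^[m] q = ((D : MvPolynomial (Fin 2) k →ₗ[k] MvPolynomial (Fin 2) k) ^ m) q :=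
          fun q => by simp [Module.End.pow_apply]
        simp only [this, map_sum, map_smul]
      rw [hlin, map_sum, Finset.mul_sum]
      simp only [Finset.sum_apply, Pi.smul_apply, v, Pi.mul_apply, Pi.pow_apply,
        Pi.zero_apply] at h1
      rw [← h1]
      refine Finset.sum_congr rfl fun i _ => ?_
      rw [map_smul, smul_eq_mul, smul_eq_mul]
      ring
    exact (mul_eq_zero.1 h3).resolve_left (pow_ne_zero _ h2)
  · refine Nat.mul_le_mul_right _ ?_
    have h1 : p * (B - 1) ≤ p * B := Nat.mul_le_mul_left _ (by omega)
    have h2 : n * (n + p * (n - 1)) ≤ n * (n + p * n) :=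
      Nat.mul_le_mul_left _ (by have := Nat.mul_le_mul_left p (Nat.sub_le n 1); omega)
    omega

end AuxiliaryPolynomial

section SimpleRoot

theorem exists_map_intCast_eq_C_mul (q : ℚ[X]) :
    ∃ b : ℤ, b ≠ 0 ∧ ∃ Q : ℤ[X], Q.map (Int.castRingHom ℚ) = C (b : ℚ) * q := by
  obtain ⟨b, hb, hQ⟩ := IsLocalization.integerNormalization_spec (nonZeroDivisors ℤ) q
  refine ⟨b, nonZeroDivisors.ne_zero hb, IsLocalization.integerNormalization (nonZeroDivisors ℤ) q, ?_⟩
  rw [← smul_eq_C_mul, Int.cast_smul_eq_zsmul]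
  exact hQ

theorem exists_simple_root_of_not_squarefullPoly_s19 {F : ℤ[X]} (hF : F ≠ 0)
    (h : ¬ SquarefullPoly F) : ∃ z : ℂ, aeval z F = 0 ∧ aeval z (derivative F) ≠ 0 := by
  have hF' : F.map (Int.castRingHom ℂ) ≠ 0 :=
    (Polynomial.map_ne_zero_iff (RingHom.injective_int _)).2 hF
  simp only [SquarefullPoly, not_forall, exists_prop] at h
  obtain ⟨z, hz, hz2⟩ := h
  refine ⟨z, ?_, fun hd => hz2 ((one_lt_rootMultiplicity_iff_isRoot hF').2 ⟨hz, ?_⟩)⟩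
  · rwa [IsRoot.def, eval_map, ← algebraMap_int_eq, ← aeval_def] at hz
  · rwa [derivative_map, IsRoot.def, eval_map, ← algebraMap_int_eq, ← aeval_def]

/-- A polynomial with a simple complex root keeps its degree and acquires a simple root modulo
all but finitely many primes. -/
theorem exists_simple_root_mod_prime {F : ℤ[X]} (hF : F ≠ 0) (h : ¬ SquarefullPoly F) :
    ∃ N : ℤ, N ≠ 0 ∧ ∀ p : ℕ, ¬ (p : ℤ) ∣ N →
      ∀ (k : Type) [Field k] [CharP k p] [IsAlgClosed k],
        Int.castRingHom k F.leadingCoeff ≠ 0 ∧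
          ∃ α : k, aeval α F = 0 ∧ aeval α (derivative F) ≠ 0 := by
  obtain ⟨z, hz, hz'⟩ := exists_simple_root_of_not_squarefullPoly_s19 hF h
  have hmap : ∀ Q : ℤ[X], aeval z (Q.map (Int.castRingHom ℚ)) = aeval z Q := fun Q => by
    rw [← algebraMap_int_eq, aeval_map_algebraMap]
  have hz_int : IsIntegral ℚ z := by
    refine (isAlgebraic_iff_isIntegral).1 ⟨F.map (Int.castRingHom ℚ), ?_, ?_⟩
    · exact (Polynomial.map_ne_zero_iff (RingHom.injective_int _)).2 hF
    · rw [hmap, hz]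
  obtain ⟨q, hq⟩ := minpoly.dvd ℚ z ((hmap F).trans hz)
  have hcop : IsCoprime (minpoly ℚ z) ((derivative F).map (Int.castRingHom ℚ)) := by
    rw [(minpoly.irreducible hz_int).coprime_iff_not_dvd]
    rintro ⟨r, hr⟩
    refine hz' ?_
    rw [← hmap, hr, map_mul, minpoly.aeval, zero_mul]
  obtain ⟨u, v, huv⟩ := hcop
  obtain ⟨b₁, hb₁, H, hH⟩ := exists_map_intCast_eq_C_mul (minpoly ℚ z)
  obtain ⟨b₂, hb₂, Q, hQ⟩ := exists_map_intCast_eq_C_mul q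
  obtain ⟨b₃, hb₃, U, hU⟩ := exists_map_intCast_eq_C_mul u
  obtain ⟨b₄, hb₄, V, hV⟩ := exists_map_intCast_eq_C_mul v
  have hinj := Polynomial.map_injective (Int.castRingHom ℚ) (RingHom.injective_int _)
  have e1 : H * Q = C (b₁ * b₂) * F := by
    apply hinj
    simp only [Polynomial.map_mul, hH, hQ, hq, map_C, map_mul, eq_intCast (Int.castRingHom ℚ)]
    ring
  have e2 : C b₄ * U * H + C (b₁ * b₃) * V * derivative F = C (b₁ * b₃ * b₄) := by
    apply hinj
    simp only [Polynomial.map_add, Polynomial.map_mul, hH, hU, hV, map_C, map_mul, eq_intCast (Int.castRingHom ℚ)]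
    linear_combination (C (b₁ : ℚ) * C (b₃ : ℚ) * C (b₄ : ℚ)) * huv
  have hHdeg : 0 < H.natDegree := by
    rw [← natDegree_map_eq_of_injective (RingHom.injective_int (Int.castRingHom ℚ)), hH,
      natDegree_C_mul (by exact_mod_cast hb₁)]
    exact minpoly.natDegree_pos hz_int
  have hlc : H.leadingCoeff * Q.leadingCoeff = b₁ * b₂ * F.leadingCoeff := by
    rw [← leadingCoeff_mul, e1, leadingCoeff_mul, leadingCoeff_C]
  refine ⟨b₁ * b₂ * b₃ * b₄ * F.leadingCoeff, by simp [*], ?_⟩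
  intro p hpN k _ _ _
  have hne : ((b₁ * b₂ * b₃ * b₄ * F.leadingCoeff : ℤ) : k) ≠ 0 := by
    rwa [Ne, CharP.intCast_eq_zero_iff k p]
  push_cast at hne
  simp only [mul_ne_zero_iff] at hne
  obtain ⟨⟨⟨⟨h1, h2⟩, h3⟩, h4⟩, h5⟩ := hne
  have hHlc : (Int.castRingHom k) H.leadingCoeff ≠ 0 := by
    have := congrArg (Int.cast : ℤ → k) hlc
    push_cast at this
    refine left_ne_zero_of_mul (this.trans_ne ?_)
    simp [*]
  obtain ⟨α, hα⟩ := IsAlgClosed.exists_root (H.map (Int.castRingHom k)) (by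
    refine (natDegree_pos_iff_degree_pos.1 ?_).ne'
    rwa [natDegree_map_of_leadingCoeff_ne_zero _ hHlc])
  have hα : aeval α H = 0 := by
    rwa [IsRoot.def, eval_map, ← algebraMap_int_eq, ← aeval_def] at hα
  refine ⟨h5, α, ?_, fun h0 => ?_⟩
  · have := congrArg (aeval α) e1
    rw [map_mul, map_mul, hα, zero_mul, aeval_C] at this
    refine (mul_eq_zero.1 this.symm).resolve_left ?_
    simp [h1, h2]
  · have := congrArg (aeval α) e2
    simp [hα, h0, h1, h3, h4] at this

end SimpleRoot

section CountModPrime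

theorem Nat.exists_stepanov_parameters {n p : ℕ} (hn : 0 < n)
    (hp : (2 * n ^ 2 + n + 4) ^ 2 ≤ p) :
    ∃ M A B : ℕ, 0 < M ∧ M ≤ p ∧ M = p.sqrt ∧ n * A ≤ p ∧ n * B ≤ M + n * (n ^ 2 + n + 4) ∧
      ∑ m ∈ Finset.range M, (A + B + m * n + n * (n + m * n)) * n < A * n * (B * n) := by
  set M := p.sqrt with hMdef
  have hM1 : 2 * n ^ 2 + n + 4 ≤ M := Nat.le_sqrt'.2 hp
  have hM2 : M ^ 2 ≤ p := Nat.sqrt_le' p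
  set c := n ^ 2 + n + 4 with hc
  have hA1 := Nat.div_mul_le_self p n
  have hA2 := Nat.lt_div_mul_add (a := p) hn
  have hB1 := Nat.div_mul_le_self M n
  have hB2 := Nat.lt_div_mul_add (a := M) hn
  set A := p / n
  set B₀ := M / n
  refine ⟨M, A, B₀ + c, by omega, by nlinarith, rfl, by linarith, by nlinarith, ?_⟩
  have hsum : ∑ m ∈ Finset.range M, (A + (B₀ + c) + m * n + n * (n + m * n)) * n ≤
      M * ((A + (B₀ + c) + M * n + n * (n + M * n)) * n) := by
    rw [← smul_eq_mul M, ← Finset.card_range M, ← Finset.sum_const, Finset.card_range]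
    refine Finset.sum_le_sum fun m hm => ?_
    have hm := (Finset.mem_range.1 hm).le
    gcongr
  refine hsum.trans_lt ?_
  have hB0 : B₀ ≤ M := Nat.div_le_self _ _
  have key : M * (A + (B₀ + c) + M * n + n * (n + M * n)) < A * ((B₀ + c) * n) := by
    zify at *
    have h1 : (A : ℤ) * (M + n * (c - 1)) ≤ A * ((B₀ + c) * n) := by
      refine mul_le_mul_of_nonneg_left ?_ (by positivity)
      nlinarith
    have hc1 : (0 : ℤ) ≤ c - 1 := by rw [hc]; nlinarith
    have h2 : ((M : ℤ) ^ 2 - n) * (c - 1) ≤ A * n * (c - 1) :=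
      mul_le_mul_of_nonneg_right (by linarith) hc1
    have h3 : (M : ℤ) * ((B₀ + c) + M * n + n * (n + M * n)) ≤
        M ^ 2 * (1 + n + n ^ 2) + M * (c + n ^ 2) := by
      have : (M : ℤ) * B₀ ≤ M * M := mul_le_mul_of_nonneg_left hB0 (by positivity)
      nlinarith
    have h4 : (M : ℤ) * (c + n ^ 2) ≤ M * M := by
      refine mul_le_mul_of_nonneg_left ?_ (by positivity)
      rw [hc]; linarith
    have h5 : (n : ℤ) * (c - 1) < M ^ 2 := by
      rw [hc]
      have : (2 * (n : ℤ) ^ 2 + n + 4) ^ 2 ≤ M ^ 2 := by gcongr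
      have hn1 : (1 : ℤ) ≤ n := hn
      nlinarith [pow_pos (by linarith : (0 : ℤ) < n) 3, pow_pos (by linarith : (0 : ℤ) < n) 4]
    have h6 : ((M : ℤ) ^ 2 - n) * (c - 1) = M ^ 2 * (n ^ 2 + n + 3) - n * (c - 1) := by
      rw [hc]; ring
    nlinarith
  calc _ = M * (A + (B₀ + c) + M * n + n * (n + M * n)) * n := by ring
    _ < A * ((B₀ + c) * n) * n := Nat.mul_lt_mul_of_pos_right key hn
    _ = _ := by ring

end CountModPrime

section SimpleRootCount

variable {k : Type*} [Field k]

theorem coeff_zero_comp_X_add_C (f : k[X]) (α : k) :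
    (f.comp (X + C α)).coeff 0 = f.eval α := by
  rw [coeff_zero_eq_eval_zero, eval_comp]
  simp

theorem coeff_one_comp_X_add_C (f : k[X]) (α : k) :
    (f.comp (X + C α)).coeff 1 = (derivative f).eval α := by
  have h : (derivative (f.comp (X + C α))).coeff 0 = (f.comp (X + C α)).coeff 1 := by
    rw [coeff_derivative]
    simp
  rw [← h, derivative_comp, coeff_zero_eq_eval_zero]
  simp [eval_comp]

theorem card_filter_eval_mul_eval_eq_le [Fintype k] {f g : k[X]} (hf : 0 < f.natDegree)
    (hg : g ≠ 0) {w : k} (hw : w ≠ 0) :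
    (Finset.univ.filter fun v : k × k => f.eval v.1 * f.eval v.2 = w ∧ g.eval v.2 = 0).card ≤
      f.natDegree * g.natDegree := by
  set T := Finset.univ.filter fun v : k × k => f.eval v.1 * f.eval v.2 = w ∧ g.eval v.2 = 0
  have himage : (T.image Prod.snd).card ≤ g.natDegree := by
    refine le_trans (Finset.card_le_card (t := g.roots.toFinset) ?_)
      ((Multiset.toFinset_card_le _).trans (card_roots' g))
    intro b hb
    obtain ⟨v, hv, rfl⟩ := Finset.mem_image.1 hb
    simpa [hg] using (Finset.mem_filter.1 hv).2.2
  refine le_trans (Finset.card_le_mul_card_image (f := Prod.snd) T f.natDegree ?_)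
    (Nat.mul_le_mul_left _ himage)
  intro b hb
  have hne : f - C (w / f.eval b) ≠ 0 := by
    intro h
    rw [sub_eq_zero.1 h, natDegree_C] at hf
    exact hf.false
  calc _ ≤ ((f - C (w / f.eval b)).roots.toFinset ×ˢ {b}).card := ?_
    _ = (f - C (w / f.eval b)).roots.toFinset.card := by simp
    _ ≤ (f - C (w / f.eval b)).natDegree :=
      (Multiset.toFinset_card_le _).trans (card_roots' _)
    _ = f.natDegree := natDegree_sub_C
  refine Finset.card_le_card fun v hv => ?_
  obtain ⟨hvT, rfl⟩ := Finset.mem_filter.1 hv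
  have hv := (Finset.mem_filter.1 hvT).2.1
  have h2 : f.eval v.2 ≠ 0 := right_ne_zero_of_mul (hv.trans_ne hw)
  simp only [Finset.mem_product, Multiset.mem_toFinset, mem_roots hne, Finset.mem_singleton,
    and_true, IsRoot.def, eval_sub, eval_C, sub_eq_zero]
  exact eq_div_of_mul_eq h2 hv

theorem card_separable_points_le {p : ℕ} [Fact p.Prime] [Algebra (ZMod p) k] {f : (ZMod p)[X]}
    (hf : 0 < f.natDegree) {α : k} (hα : aeval α f = 0) (hα' : aeval α (derivative f) ≠ 0)
    {w : ZMod p} (hw : w ≠ 0)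
    (hp : (2 * f.natDegree ^ 2 + f.natDegree + 4) ^ 2 ≤ p) :
    Fintype.card {v : ZMod p × ZMod p //
        f.eval v.1 * f.eval v.2 = w ∧ (derivative f).eval v.2 ≠ 0} ≤
      p + 3 * (1 + f.natDegree * (f.natDegree ^ 2 + f.natDegree + 4) + 2 * f.natDegree ^ 3) *
        p.sqrt := by
  set n := f.natDegree with hn
  obtain ⟨M, A, B, hM0, hMp, hM, hA, hB, hcount⟩ := Nat.exists_stepanov_parameters hf hp
  have hprime : p.Prime := Fact.out
  have : CharP k p := charP_of_injective_algebraMap (algebraMap (ZMod p) k).injective p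
  have hev : ∀ (q : (ZMod p)[X]) (t : ZMod p),
      (q.map (algebraMap (ZMod p) k)).eval (algebraMap _ _ t) = algebraMap (ZMod p) k (q.eval t) :=
    fun q t => by rw [eval_map_algebraMap, aeval_algebraMap_apply, coe_aeval_eq_eval]
  have hbound := mul_card_le_of_pow_char_eq (k := k) (p := p) (n := n) (M := M) (A := A) (B := B)
    (F₁ := (f.map (algebraMap _ k)).comp (X + C α)) (F₂ := f.map (algebraMap _ k))
    (w := algebraMap _ k w) (δ := α - α ^ p)
    (S := {v : ZMod p × ZMod p // f.eval v.1 * f.eval v.2 = w ∧ (derivative f).eval v.2 ≠ 0})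
    (a := fun s => algebraMap _ k s.1.1 - α) (b := fun s => algebraMap _ k s.1.2)
    hprime hf (by simpa using hw) (by simp [natDegree_comp, hn]) (by simp [hn])
    (by rw [coeff_zero_comp_X_add_C, eval_map_algebraMap, hα])
    (by rw [coeff_one_comp_X_add_C, derivative_map, eval_map_algebraMap]; exact hα')
    (by
      intro s t hst
      simp only [Prod.mk.injEq, sub_left_inj, (algebraMap (ZMod p) k).injective.eq_iff] at hst
      exact Subtype.ext (Prod.ext hst.1 hst.2))
    (by
      intro s
      rw [eval_comp]
      simp only [eval_add, eval_X, eval_C, sub_add_cancel]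
      rw [hev, hev, ← map_mul, s.2.1])
    (by
      intro s
      rw [derivative_map, hev]
      simpa using s.2.2)
    (by
      intro s
      rw [sub_pow_char, ← map_pow, ZMod.pow_card]
      ring)
    (by
      intro s
      rw [← map_pow, ZMod.pow_card])
    hMp hA hcount
  have hpM : p < (M + 1) * (M + 1) := hM ▸ Nat.lt_succ_sqrt p
  have hpM3 : p ≤ 3 * M * M := by nlinarith
  rw [← hM]
  refine Nat.le_of_mul_le_mul_right (hbound.trans ?_) hM0
  set K := 1 + n * (n ^ 2 + n + 4) + 2 * n ^ 3 with hK
  have h1 : (A + p * B + n * (n + p * n)) * n ≤ p * M + p * K := by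
    have hp1 := hprime.one_le
    have : p * (n * B) ≤ p * (M + n * (n ^ 2 + n + 4)) := Nat.mul_le_mul_left _ hB
    have : n ^ 3 ≤ p * n ^ 3 := Nat.le_mul_of_pos_left _ hp1
    rw [hK]
    nlinarith
  calc _ ≤ p * M + p * K := h1
    _ ≤ p * M + 3 * M * M * K := by gcongr
    _ = _ := by ring

theorem card_filter_eval_mul_eval_eq_le_of_simple_root {p : ℕ} [Fact p.Prime]
    [Algebra (ZMod p) k] {f : (ZMod p)[X]}
    (hf : 0 < f.natDegree) {α : k} (hα : aeval α f = 0) (hα' : aeval α (derivative f) ≠ 0)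
    {w : ZMod p} (hw : w ≠ 0)
    (hp : (2 * f.natDegree ^ 2 + f.natDegree + 4) ^ 2 ≤ p) :
    (Finset.univ.filter fun v : ZMod p × ZMod p => f.eval v.1 * f.eval v.2 = w).card ≤
      p + 3 * (1 + f.natDegree * (f.natDegree ^ 2 + f.natDegree + 4) + 2 * f.natDegree ^ 3) *
        p.sqrt + f.natDegree ^ 2 := by
  have hd : derivative f ≠ 0 := by
    intro h
    simp [h] at hα'
  rw [← Finset.card_filter_add_card_filter_not fun v : ZMod p × ZMod p =>
    (derivative f).eval v.2 ≠ 0, Finset.filter_filter, Finset.filter_filter]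
  refine Nat.add_le_add ?_ ?_
  · rw [← Fintype.card_subtype]
    exact card_separable_points_le hf hα hα' hw hp
  · simp only [not_not]
    refine le_trans (le_of_eq (by congr)) ((card_filter_eval_mul_eval_eq_le hf hd hw).trans ?_)
    rw [pow_two]
    exact Nat.mul_le_mul_left _ ((natDegree_derivative_le f).trans (Nat.sub_le _ _))

end SimpleRootCount

section PointCountCurve

theorem aeval_eq_eval_map_castRingHom {R : Type*} [CommRing R] (F : ℤ[X]) (t : R) :
    aeval t F = (F.map (Int.castRingHom R)).eval t := by
  rw [eval_map, aeval_def, algebraMap_int_eq]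

theorem exists_forall_prime_gt_simple_root {F : ℤ[X]} (hF : F ≠ 0) (h : ¬ SquarefullPoly F) :
    ∃ N : ℕ, ∀ (p : ℕ) [Fact p.Prime], N < p →
      (F.map (Int.castRingHom (ZMod p))).natDegree = F.natDegree ∧
        ∃ α : AlgebraicClosure (ZMod p), aeval α (F.map (Int.castRingHom (ZMod p))) = 0 ∧
          aeval α (derivative (F.map (Int.castRingHom (ZMod p)))) ≠ 0 := by
  obtain ⟨N, hN, hroot⟩ := exists_simple_root_mod_prime hF h
  refine ⟨N.natAbs, fun p _ hp => ?_⟩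
  have hpN : ¬ (p : ℤ) ∣ N := fun hd =>
    absurd (Nat.le_of_dvd (Int.natAbs_pos.2 hN) (Int.natCast_dvd.1 hd)) (not_le.2 hp)
  have : CharP (AlgebraicClosure (ZMod p)) p :=
    charP_of_injective_algebraMap (algebraMap (ZMod p) _).injective p
  obtain ⟨hlc, α, h0, h1⟩ := hroot p hpN (AlgebraicClosure (ZMod p))
  have hα : ∀ Q : ℤ[X], aeval α (Q.map (Int.castRingHom (ZMod p))) = aeval α Q := fun Q => by
    rw [← algebraMap_int_eq, aeval_map_algebraMap]
  refine ⟨natDegree_map_of_leadingCoeff_ne_zero _ fun h => hlc ?_, α, ?_, ?_⟩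
  · rw [eq_intCast] at h ⊢
    rw [← map_intCast (algebraMap (ZMod p) (AlgebraicClosure (ZMod p))), h, map_zero]
  · rwa [hα]
  · rwa [derivative_map, hα]

theorem card_units_points_curve_le {F : ℤ[X]} (hF : 0 < F.natDegree) (h : ¬ SquarefullPoly F) :
    ∃ K N : ℕ, ∀ (p : ℕ) [Fact p.Prime], N < p → ∀ w : (ZMod p)ˣ,
      Nat.card {v : (ZMod p)ˣ × (ZMod p)ˣ //
        aeval (v.1 : ZMod p) F * aeval (v.2 : ZMod p) F = (w : ZMod p)} ≤
          p + K * p.sqrt + K := by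
  set n := F.natDegree with hn
  obtain ⟨N, hN⟩ := exists_forall_prime_gt_simple_root (ne_zero_of_natDegree_gt hF) h
  refine ⟨3 * (1 + n * (n ^ 2 + n + 4) + 2 * n ^ 3) + n ^ 2,
    N + (2 * n ^ 2 + n + 4) ^ 2, fun p _ hp w => ?_⟩
  obtain ⟨hdeg, α, hα, hα'⟩ := hN p (by omega)
  have hbound := card_filter_eval_mul_eval_eq_le_of_simple_root (hdeg ▸ hF) hα hα' w.ne_zero
    (by rw [hdeg, ← hn]; omega)
  rw [hdeg, ← hn] at hbound
  refine le_trans ?_ (hbound.trans (by nlinarith))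
  rw [← Fintype.card_subtype, ← Nat.card_eq_fintype_card]
  refine Nat.card_le_card_of_injective
    (fun v => ⟨(v.1.1, v.1.2), by simpa only [aeval_eq_eval_map_castRingHom] using v.2⟩) ?_
  intro v v' hvv
  simp only [Subtype.mk.injEq, Prod.mk.injEq, Units.val_inj] at hvv
  exact Subtype.ext (Prod.ext hvv.1 hvv.2)

theorem exists_card_units_points_curve_le {F : ℤ[X]} (hF : 0 < F.natDegree)
    (h : ¬ SquarefullPoly F) :
    ∃ A : ℝ, 0 < A ∧ ∀ p : ℕ, p.Prime → ∀ w : (ZMod p)ˣ,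
      (Nat.card {v : (ZMod p)ˣ × (ZMod p)ˣ //
        aeval (v.1 : ZMod p) F * aeval (v.2 : ZMod p) F = (w : ZMod p)} : ℝ) ≤
          (p.totient : ℝ) * (1 + A * (p : ℝ) ^ (-(1 : ℝ) / 2)) := by
  obtain ⟨K, N, hKN⟩ := card_units_points_curve_le hF h
  refine ⟨4 * K + 2 + N ^ 2, by positivity, fun p hp w => ?_⟩
  have := Fact.mk hp
  have hp2 : (2 : ℝ) ≤ p := by exact_mod_cast hp.two_le
  have hs : (p : ℝ) ^ (-(1 : ℝ) / 2) = (√p)⁻¹ := by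
    rw [Real.sqrt_eq_rpow, ← Real.rpow_neg (by positivity)]
    norm_num
  have hs1 : 1 ≤ √(p : ℝ) := Real.one_le_sqrt.2 (by linarith)
  have hs0 : 0 < √(p : ℝ) := by linarith
  have hss : √(p : ℝ) * √(p : ℝ) = p := Real.mul_self_sqrt (by positivity)
  have htot : (p.totient : ℝ) = p - 1 := by
    rw [Nat.totient_prime hp, Nat.cast_sub hp.one_le, Nat.cast_one]
  rw [hs]
  rcases le_or_gt p N with hpN | hpN
  · have hcard : (Nat.card {v : (ZMod p)ˣ × (ZMod p)ˣ //
        aeval (v.1 : ZMod p) F * aeval (v.2 : ZMod p) F = (w : ZMod p)} : ℝ) ≤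
          p.totient * p.totient := by
      rw [← ZMod.card_units_eq_totient]
      norm_cast
      rw [← Fintype.card_prod, ← Nat.card_eq_fintype_card]
      exact Nat.card_le_card_of_injective _ Subtype.val_injective
    refine hcard.trans (mul_le_mul_of_nonneg_left ?_ (by positivity))
    have hN : (p : ℝ) ≤ N := by exact_mod_cast hpN
    have h1 : (p : ℝ) ≤ (4 * K + 2 + N ^ 2) * (√p)⁻¹ := by
      rw [← div_eq_mul_inv, le_div_iff₀ hs0]
      have : (0 : ℝ) ≤ K := by positivity
      nlinarith
    linarith
  · have hcard : (Nat.card {v : (ZMod p)ˣ × (ZMod p)ˣ //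
        aeval (v.1 : ZMod p) F * aeval (v.2 : ZMod p) F = (w : ZMod p)} : ℝ) ≤
          p + K * p.sqrt + K := by exact_mod_cast hKN p hpN w
    refine hcard.trans ?_
    have hsq : (p.sqrt : ℝ) ≤ √p := Real.nat_sqrt_le_real_sqrt
    have hK : (0 : ℝ) ≤ K := by positivity
    have h1 : (p : ℝ) + K * p.sqrt + K ≤ p - 1 + (2 * K + 1) * √p := by nlinarith
    have h2 : (2 * K + 1) * √(p : ℝ) ≤ (p - 1) * ((4 * K + 2 + N ^ 2) * (√p)⁻¹) := by
      rw [← div_eq_mul_inv, ← mul_div_assoc, le_div_iff₀ hs0, mul_assoc, hss]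
      nlinarith [mul_nonneg (by linarith : (0 : ℝ) ≤ p - 1) (sq_nonneg (N : ℝ)),
        mul_nonneg hK (by linarith : (0 : ℝ) ≤ p - 2)]
    rw [htot]
    linarith

end PointCountCurve

section TwoCurves

variable {k : Type*} [Field k] {F₁ F₂ : k[X]} {n : ℕ} {w : k} {z : PowerSeries k}

theorem LaurentSeries.order_algebraMap_coeff (c : k) :
    (algebraMap k (LaurentSeries k) c).order = 0 := by
  rw [show algebraMap k (LaurentSeries k) c = HahnSeries.C c from HahnSeries.algebraMap_apply]
  exact HahnSeries.order_C

theorem LaurentSeries.aeval_algebraMap_ne_zero (hz : PowerSeries.constantCoeff z = 0)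
    (hz0 : algebraMap (PowerSeries k) (LaurentSeries k) z ≠ 0) (q : k[X]) (hq : q ≠ 0) :
    aeval (algebraMap (PowerSeries k) (LaurentSeries k) z) q ≠ 0 := by
  obtain ⟨r, hr, hc⟩ := exists_X_pow_mul_eq_constantCoeff_aeval_ne_zero hz hq
  rw [hr, map_mul, map_pow, aeval_X, aeval_algebraMap_apply]
  exact mul_ne_zero (pow_ne_zero _ hz0) (LaurentSeries.algebraMap_ne_zero hc)

theorem LaurentSeries.aeval_single_neg_one_ne_zero {q : k[X]} (hq : q ≠ 0) :
    aeval (HahnSeries.single (-1) 1 : LaurentSeries k) q ≠ 0 := by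
  rw [LaurentSeries.aeval_single_neg_one]
  exact mul_ne_zero (LaurentSeries.algebraMap_ne_zero (constantCoeff_aeval_powerSeriesX_reverse hq))
    (pow_ne_zero _ (HahnSeries.single_ne_zero one_ne_zero))

/-- If `H(y)` is a rational function of `x` on the curve `F₁(x) F₂(y) = w`, totally ramified at
a pole of `y`, then `H` is a polynomial in `F₂`. -/
theorem exists_eq_comp_of_aeval_mul_eq (hn : 0 < n) (h₂ : F₂.natDegree = n) (hF₁ : F₁ ≠ 0)
    (hz0 : PowerSeries.constantCoeff z = 0)
    (hz : (algebraMap (PowerSeries k) (LaurentSeries k) z).order = n)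
    (hzne : algebraMap (PowerSeries k) (LaurentSeries k) z ≠ 0)
    (hxy : aeval (algebraMap (PowerSeries k) (LaurentSeries k) z) F₁ *
      aeval (HahnSeries.single (-1) 1 : LaurentSeries k) F₂ = algebraMap k _ w) (d : ℕ) :
    ∀ H p q : k[X], H.natDegree ≤ d → q ≠ 0 →
      aeval (algebraMap (PowerSeries k) (LaurentSeries k) z) q *
        aeval (HahnSeries.single (-1) 1 : LaurentSeries k) H =
          aeval (algebraMap (PowerSeries k) (LaurentSeries k) z) p →
      ∃ Q : k[X], H = Q.comp F₂ := by
  induction d with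
  | zero =>
    intro H p q hH _ _
    exact ⟨C (H.coeff 0), by rw [C_comp]; exact eq_C_of_natDegree_le_zero hH⟩
  | succ d ih =>
    intro H p q hH hq hHp
    set x := algebraMap (PowerSeries k) (LaurentSeries k) z with hx
    set y : LaurentSeries k := HahnSeries.single (-1) 1 with hy
    rcases Nat.eq_zero_or_pos H.natDegree with hH0 | hHpos
    · exact ⟨C (H.coeff 0), by rw [C_comp]; exact eq_C_of_natDegree_le_zero hH0.le⟩
    have hHne := ne_zero_of_natDegree_gt hHpos
    have hxne : ∀ r : k[X], r ≠ 0 → aeval x r ≠ 0 := LaurentSeries.aeval_algebraMap_ne_zero hz0 hzne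
    have hyne : aeval y H ≠ 0 := LaurentSeries.aeval_single_neg_one_ne_zero hHne
    have hpne : p ≠ 0 := by
      rintro rfl
      rw [map_zero] at hHp
      exact mul_ne_zero (hxne q hq) hyne hHp
    have hord := congrArg HahnSeries.order hHp
    rw [HahnSeries.order_mul (hxne q hq) hyne, LaurentSeries.order_aeval_algebraMap hz0 hq hzne,
      LaurentSeries.order_aeval_algebraMap hz0 hpne hzne, LaurentSeries.order_aeval_single_neg_one
      hHne, hz] at hord
    obtain ⟨e, he⟩ : n ∣ H.natDegree := by
      rw [← Int.natCast_dvd_natCast]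
      exact ⟨q.natTrailingDegree - p.natTrailingDegree, by linarith⟩
    have hF₂ : F₂ ≠ 0 := ne_zero_of_natDegree_gt (h₂ ▸ hn)
    set c := H.leadingCoeff / F₂.leadingCoeff ^ e with hc
    have hcne : c ≠ 0 := div_ne_zero (leadingCoeff_ne_zero.2 hHne)
      (pow_ne_zero _ (leadingCoeff_ne_zero.2 hF₂))
    have hlt : (H - C c * F₂ ^ e).degree < H.degree := by
      refine degree_sub_lt_left ?_ hHne ?_
      · rw [degree_eq_natDegree hHne, degree_eq_natDegree
          (mul_ne_zero (C_ne_zero.2 hcne) (pow_ne_zero _ hF₂)), natDegree_C_mul hcne,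
          natDegree_pow, h₂, he, mul_comm]
      · rw [leadingCoeff_mul, leadingCoeff_C, leadingCoeff_pow, hc,
          div_mul_cancel₀ _ (pow_ne_zero _ (leadingCoeff_ne_zero.2 hF₂))]
    have hdeg : (H - C c * F₂ ^ e).natDegree ≤ d := by
      rcases eq_or_ne (H - C c * F₂ ^ e) 0 with h0 | h0
      · simp [h0]
      · have := natDegree_lt_natDegree h0 hlt
        omega
    obtain ⟨Q, hQ⟩ := ih (H - C c * F₂ ^ e) (p * F₁ ^ e - C (c * w ^ e) * q) (q * F₁ ^ e) hdeg
      (mul_ne_zero hq (pow_ne_zero _ hF₁)) (by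
        have hpow := congrArg (· ^ e) hxy
        simp only [mul_pow] at hpow
        simp only [map_mul, map_sub, map_pow, aeval_C]
        linear_combination (aeval x F₁ ^ e) * hHp - algebraMap k _ c * aeval x q * hpow)
    refine ⟨Q + C c * X ^ e, ?_⟩
    rw [add_comp, ← hQ, mul_comp, C_comp, X_pow_comp]
    ring

/-- On the curve `F₁(x) F₂(y) = w`, a relation `G₁(x) G₂(y) = u` forces `G₂` to be a multiple of a
power of `F₂`, provided `F₁` and `G₁` are translates of `F₂` and `G₂`. -/
theorem exists_eq_C_mul_pow_of_aeval_mul_aeval_eq {f g : k[X]} {α u : k} (hn : 0 < n)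
    (hf : f.natDegree = n) (hw : w ≠ 0) (hu : u ≠ 0) (hα : f.eval α = 0)
    (hz0 : PowerSeries.constantCoeff z = 0)
    (hz : (algebraMap (PowerSeries k) (LaurentSeries k) z).order = n)
    (hzne : algebraMap (PowerSeries k) (LaurentSeries k) z ≠ 0)
    (hxy : aeval (algebraMap (PowerSeries k) (LaurentSeries k) z) (f.comp (X + C α)) *
      aeval (HahnSeries.single (-1) 1 : LaurentSeries k) f = algebraMap k _ w)
    (hg : aeval (algebraMap (PowerSeries k) (LaurentSeries k) z) (g.comp (X + C α)) *
      aeval (HahnSeries.single (-1) 1 : LaurentSeries k) g = algebraMap k _ u) :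
    ∃ (c : k) (e : ℕ), g = C c * f ^ e := by
  set x := algebraMap (PowerSeries k) (LaurentSeries k) z with hx
  set y : LaurentSeries k := HahnSeries.single (-1) 1 with hy
  have hne : algebraMap k (LaurentSeries k) u ≠ 0 := by simpa using hu
  have hne' : algebraMap k (LaurentSeries k) w ≠ 0 := by simpa using hw
  have hg₁ : aeval x (g.comp (X + C α)) ≠ 0 := left_ne_zero_of_mul (hg.trans_ne hne)
  have hf₁ : aeval x (f.comp (X + C α)) ≠ 0 := left_ne_zero_of_mul (hxy.trans_ne hne')
  have hf₂ : aeval y f ≠ 0 := right_ne_zero_of_mul (hxy.trans_ne hne')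
  have hg₂ : aeval y g ≠ 0 := right_ne_zero_of_mul (hg.trans_ne hne)
  have hf0 : f ≠ 0 := ne_zero_of_natDegree_gt (hf ▸ hn)
  have hg0 : g ≠ 0 := by rintro rfl; simp at hg₂
  have hfc : f.comp (X + C α) ≠ 0 := by rintro h; simp [h] at hf₁
  have hgc : g.comp (X + C α) ≠ 0 := by rintro h; simp [h] at hg₁
  obtain ⟨Q, rfl⟩ := exists_eq_comp_of_aeval_mul_eq hn hf hfc hz0 hz hzne hxy _ g (C u)
    (g.comp (X + C α)) le_rfl hgc (by rw [hg, aeval_C])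
  have hQ0 : Q ≠ 0 := by rintro rfl; simp at hg0
  have hzf : PowerSeries.constantCoeff (aeval z (f.comp (X + C α))) = 0 := by
    rw [Polynomial.aeval_def, Polynomial.hom_eval₂]
    simp [hz0, coeff_zero_comp_X_add_C, hα]
  have ht : (aeval x (f.comp (X + C α))).order = n := by
    have := congrArg HahnSeries.order hxy
    rw [HahnSeries.order_mul hf₁ hf₂, LaurentSeries.order_algebraMap_coeff,
      LaurentSeries.order_aeval_single_neg_one hf0, hf] at this
    linarith
  have hQ := congrArg HahnSeries.order hg
  rw [HahnSeries.order_mul hg₁ hg₂, LaurentSeries.order_algebraMap_coeff,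
    LaurentSeries.order_aeval_single_neg_one hg0, natDegree_comp, hf, comp_assoc, aeval_comp,
    hx, aeval_algebraMap_apply, LaurentSeries.order_aeval_algebraMap hzf hQ0
      (by rwa [← aeval_algebraMap_apply]), ← aeval_algebraMap_apply, ← hx, ht] at hQ
  have hdeg : Q.natTrailingDegree = Q.natDegree := by
    have : (n : ℤ) * (Q.natTrailingDegree - Q.natDegree) = 0 := by push_cast at hQ; linarith
    rcases mul_eq_zero.1 this with h | h
    · omega
    · omega
  obtain ⟨r, hr⟩ : X ^ Q.natTrailingDegree ∣ Q :=
    X_pow_dvd_iff.2 fun d hd => coeff_eq_zero_of_lt_natTrailingDegree hd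
  have hr0 : r ≠ 0 := by rintro rfl; simp at hr; exact hQ0 hr
  have hrd : r.natDegree = 0 := by
    have := congrArg natDegree hr
    rw [natDegree_mul (pow_ne_zero _ X_ne_zero) hr0, natDegree_X_pow, hdeg] at this
    omega
  refine ⟨r.coeff 0, Q.natTrailingDegree, ?_⟩
  conv_lhs => rw [hr, eq_C_of_natDegree_eq_zero hrd]
  rw [mul_comp, X_pow_comp, C_comp, mul_comm]

end TwoCurves

section TwoCurvesCount

variable {k : Type*} [Field k]

theorem productCurve_mem_monomialBox {F₁ F₂ : k[X]} {w : k} {m : ℕ} (h₁ : F₁.natDegree ≤ m)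
    (h₂ : F₂.natDegree ≤ m) : productCurve F₁ F₂ w ∈
      monomialBox k (MvPolynomial.X 0 : MvPolynomial (Fin 2) k) (MvPolynomial.X 1)
        (m + 1) (m + 1) := by
  refine Submodule.sub_mem _ ?_ ?_
  · have := mul_mem_monomialBox (b := 0)
      (aeval_left_mem_monomialBox (k := k) (x := (MvPolynomial.X 0 : MvPolynomial (Fin 2) k))
        (y := MvPolynomial.X 1) h₁) (aeval_right_mem_monomialBox h₂)
    exact monomialBox_mono le_rfl (by omega) this
  · rw [Algebra.algebraMap_eq_smul_one]
    refine Submodule.smul_mem _ _ ?_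
    simpa using monomial_mem_monomialBox (k := k) (x := (MvPolynomial.X 0 : MvPolynomial (Fin 2) k))
      (y := MvPolynomial.X 1) (i := 0) (j := 0) (Nat.succ_pos m) (Nat.succ_pos m)

theorem card_eval_mul_eval_eq_le {S : Type*} [Fintype S] {a b : S → k} {f g : k[X]}
    (hf : 0 < f.natDegree) {α : k} (hα : f.eval α = 0) (hα' : (derivative f).eval α ≠ 0)
    (hfg : ¬ ∃ (c : k) (e : ℕ), g = C c * f ^ e) {u w : k} (hu : u ≠ 0) (hw : w ≠ 0)
    (hab : Function.Injective fun s => (a s, b s))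
    (hfw : ∀ s, f.eval (a s) * f.eval (b s) = w) (hgu : ∀ s, g.eval (a s) * g.eval (b s) = u) :
    Fintype.card S ≤ (g.natDegree + f.natDegree * g.natDegree) * f.natDegree := by
  obtain ⟨z, hz0, hz, hzne, hxy⟩ := exists_totallyRamified_place (F₁ := f.comp (X + C α)) hf hw
    (by rw [coeff_zero_comp_X_add_C, hα]) (by rwa [coeff_one_comp_X_add_C]) rfl
  have hjet : ∀ (F G : k[X]) (c : k) (_ : ∀ s, F.eval (a s) * F.eval (b s) = c),
      (0 : Derivation k (MvPolynomial (Fin 2) k) (MvPolynomial (Fin 2) k)).jet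
        (fun s => MvPolynomial.aeval ![a s - α, b s]) 1
        (productCurve (F.comp (X + C α)) F c) = 0 := by
    intro F G c hF
    rw [Derivation.jet_eq_zero_iff]
    intro s i hi
    obtain rfl : i = 0 := by omega
    simp [aeval_productCurve, coe_aeval_eq_eval, eval_comp, hF]
  have := mul_card_le_of_jet_eq_zero (S := S) (a := fun s => a s - α) (b := b) (M := 1)
    (F₁ := f.comp (X + C α)) (F₂ := f) (w := w) (DX := g.natDegree) (DY := g.natDegree)
    (P := productCurve (g.comp (X + C α)) g u)
    hf hw (by simp [natDegree_comp]) rfl hzne (HahnSeries.single_ne_zero one_ne_zero) hz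
    (HahnSeries.order_single one_ne_zero) hxy
    (fun s t hst => hab (by simpa using hst))
    (fun s => by simp [eval_comp, hfw]) 0 (hjet f f w hfw)
    (fun s j hj => ⟨1, by omega, by obtain rfl : j = 0 := by omega
                                    simp⟩)
    (productCurve_mem_monomialBox (by simp [natDegree_comp]) le_rfl)
    (fun h => hfg (exists_eq_C_mul_pow_of_aeval_mul_aeval_eq hf rfl hw hu hα hz0 hz hzne hxy
      (by rwa [aeval_productCurve, sub_eq_zero] at h))) (hjet g g u hgu)
  simpa using this

end TwoCurvesCount

section MultIndep

variable {F G : ℤ[X]}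

theorem MultIndep.C_mul_sub_ne_zero (h : MultIndep ![F, G]) {a b : ℤ} (hb : b ≠ 0)
    (hF : F ≠ 0) (e : ℕ) : C a * G - C b * F ^ e ≠ 0 := by
  intro h0
  refine h ⟨![e, -1], fun hc => by simpa using congrFun hc 1, a / b, ?_⟩
  have hmap := congrArg (fun q : ℤ[X] => algebraMap ℚ[X] (RatFunc ℚ) (q.map (Int.castRingHom ℚ)))
    (sub_eq_zero.1 h0)
  have hne : ∀ q : ℤ[X], q ≠ 0 →
      algebraMap ℚ[X] (RatFunc ℚ) (q.map (Int.castRingHom ℚ)) ≠ 0 := fun q hq => by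
    rw [Ne, map_eq_zero_iff _ (RatFunc.algebraMap_injective ℚ)]
    exact (Polynomial.map_ne_zero_iff (RingHom.injective_int _)).2 hq
  have hG : G ≠ 0 := by
    rintro rfl
    rw [mul_zero, zero_sub, neg_eq_zero] at h0
    exact mul_ne_zero (C_ne_zero.2 hb) (pow_ne_zero _ hF) h0
  have hb' := hne _ (C_ne_zero.2 hb)
  simp only [Polynomial.map_mul, map_mul, Polynomial.map_pow, map_pow, Polynomial.map_C] at hmap hb'
  have hC : ∀ q : ℤ, algebraMap ℚ[X] (RatFunc ℚ) (C (Int.castRingHom ℚ q)) =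
      algebraMap ℚ (RatFunc ℚ) q := fun q => by
    rw [IsScalarTower.algebraMap_apply ℚ ℚ[X] (RatFunc ℚ)]
    rfl
  rw [hC] at hmap hb'
  rw [hC] at hmap
  simp only [Fin.prod_univ_two, Matrix.cons_val_zero, Matrix.cons_val_one, zpow_natCast,
    zpow_neg_one, map_div₀]
  rw [← div_eq_mul_inv, div_eq_div_iff (hne G hG) hb', hmap]
  ring

theorem MultIndep.right_ne_zero (h : MultIndep ![F, G]) : G ≠ 0 := by
  rintro rfl
  exact h ⟨![0, 1], fun hc => by simpa using congrFun hc 1, 0, by simp⟩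

theorem MultIndep.exists_forall_prime_gt (h : MultIndep ![F, G]) (hF : 0 < F.natDegree) :
    ∃ N : ℕ, ∀ (p : ℕ) [Fact p.Prime], N < p →
      ¬ ∃ (c : AlgebraicClosure (ZMod p)) (e : ℕ),
        G.map (Int.castRingHom _) = C c * F.map (Int.castRingHom _) ^ e := by
  have hF0 := ne_zero_of_natDegree_gt hF
  have hG0 := h.right_ne_zero
  set R := C (F.leadingCoeff ^ (G.natDegree / F.natDegree)) * G -
    C G.leadingCoeff * F ^ (G.natDegree / F.natDegree) with hR
  have hR0 : R ≠ 0 := h.C_mul_sub_ne_zero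
    (leadingCoeff_ne_zero.2 hG0) hF0 _
  refine ⟨(F.leadingCoeff * G.leadingCoeff * R.leadingCoeff).natAbs, fun p _ hp => ?_⟩
  rintro ⟨c, e, hce⟩
  have hlc : Int.castRingHom (AlgebraicClosure (ZMod p))
      (F.leadingCoeff * G.leadingCoeff * R.leadingCoeff) ≠ 0 := by
    intro h0
    have := charP_of_injective_algebraMap
      (algebraMap (ZMod p) (AlgebraicClosure (ZMod p))).injective p
    rw [eq_intCast, CharP.intCast_eq_zero_iff _ p, Int.natCast_dvd] at h0
    refine hp.not_ge (Nat.le_of_dvd (Int.natAbs_pos.2 ?_) h0)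
    simp [hF0, hG0, hR0]
  rw [map_mul, map_mul] at hlc
  have hlF := left_ne_zero_of_mul (left_ne_zero_of_mul hlc)
  have hlG := right_ne_zero_of_mul (left_ne_zero_of_mul hlc)
  have hlR := right_ne_zero_of_mul hlc
  set φ := Int.castRingHom (AlgebraicClosure (ZMod p))
  have hdF := natDegree_map_of_leadingCoeff_ne_zero φ hlF
  have hdG := natDegree_map_of_leadingCoeff_ne_zero φ hlG
  have hGm : G.map φ ≠ 0 := fun h0 => by
    have := leadingCoeff_map_of_leadingCoeff_ne_zero φ hlG
    rw [h0, leadingCoeff_zero] at this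
    exact hlG this.symm
  have hc : c ≠ 0 := by
    rintro rfl
    simp [hGm] at hce
  have hdeg := congrArg natDegree hce
  rw [natDegree_C_mul hc, natDegree_pow, hdF, hdG] at hdeg
  have he : G.natDegree / F.natDegree = e := by rw [hdeg, Nat.mul_div_cancel _ hF]
  have hlead := congrArg leadingCoeff hce
  rw [leadingCoeff_mul, leadingCoeff_C, leadingCoeff_pow,
    leadingCoeff_map_of_leadingCoeff_ne_zero φ hlF,
    leadingCoeff_map_of_leadingCoeff_ne_zero φ hlG] at hlead
  have hRm : R.map φ = 0 := by
    rw [hR, he]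
    simp only [Polynomial.map_sub, Polynomial.map_mul, Polynomial.map_pow, map_C, map_pow, hlead,
      hce, C_mul]
    ring
  have := leadingCoeff_map_of_leadingCoeff_ne_zero φ hlR
  rw [hRm, leadingCoeff_zero] at this
  exact hlR this.symm

end MultIndep

section PointCountSurface

variable {F G : ℤ[X]}

theorem exists_card_units_points_two_curves_le (hF : 0 < F.natDegree) (hF' : ¬ SquarefullPoly F)
    (hFG : MultIndep ![F, G]) :
    ∃ K N : ℕ, ∀ (p : ℕ) [Fact p.Prime], N < p → ∀ u w : ZMod p, u ≠ 0 → w ≠ 0 →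
      Fintype.card {v : (ZMod p)ˣ × (ZMod p)ˣ //
        aeval (v.1 : ZMod p) F * aeval (v.2 : ZMod p) F = u ∧
        aeval (v.1 : ZMod p) G * aeval (v.2 : ZMod p) G = w} ≤ K := by
  obtain ⟨N₁, hN₁⟩ := exists_forall_prime_gt_simple_root (ne_zero_of_natDegree_gt hF) hF'
  obtain ⟨N₂, hN₂⟩ := hFG.exists_forall_prime_gt hF
  refine ⟨(G.natDegree + F.natDegree * G.natDegree) * F.natDegree, max N₁ N₂,
    fun p _ hp u w hu hw => ?_⟩
  obtain ⟨hdeg, α, hα, hα'⟩ := hN₁ p (lt_of_le_of_lt (le_max_left _ _) hp)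
  set ι := algebraMap (ZMod p) (AlgebraicClosure (ZMod p)) with hι
  have hmap : ∀ Q : ℤ[X], (Q.map (Int.castRingHom (ZMod p))).map ι =
      Q.map (Int.castRingHom (AlgebraicClosure (ZMod p))) := fun Q => by
    rw [Polynomial.map_map]
    congr 1
  have heval : ∀ (Q : ℤ[X]) (t : ZMod p),
      (Q.map (Int.castRingHom (AlgebraicClosure (ZMod p)))).eval (ι t) = ι (aeval t Q) :=
    fun Q t => by
      rw [← hmap, eval_map_algebraMap, aeval_algebraMap_apply, coe_aeval_eq_eval,
        aeval_eq_eval_map_castRingHom]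
  have hdF : (F.map (Int.castRingHom (AlgebraicClosure (ZMod p)))).natDegree = F.natDegree := by
    rw [← hmap, natDegree_map, hdeg]
  have hbound := card_eval_mul_eval_eq_le (hdF.symm ▸ hF) (α := α)
    (by rw [← hmap, eval_map_algebraMap, hα])
    (by rwa [← hmap, derivative_map, eval_map_algebraMap])
    (hN₂ p (lt_of_le_of_lt (le_max_right _ _) hp))
    (S := {v : (ZMod p)ˣ × (ZMod p)ˣ //
        aeval (v.1 : ZMod p) F * aeval (v.2 : ZMod p) F = u ∧
        aeval (v.1 : ZMod p) G * aeval (v.2 : ZMod p) G = w})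
    (a := fun v => ι (v.1.1 : ZMod p)) (b := fun v => ι (v.1.2 : ZMod p)) (w := ι u) (u := ι w)
    (by simpa using hw) (by simpa using hu)
    (fun v v' hvv => by
      simp only [Prod.mk.injEq, ι.injective.eq_iff, Units.val_inj] at hvv
      exact Subtype.ext (Prod.ext hvv.1 hvv.2))
    (fun v => by rw [heval, heval, ← map_mul, v.2.1])
    (fun v => by rw [heval, heval, ← map_mul, v.2.2])
  rw [hdF] at hbound
  refine hbound.trans ?_
  have := natDegree_map_le (f := Int.castRingHom (AlgebraicClosure (ZMod p))) (p := G)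
  gcongr

theorem exists_card_units_points_surface_le (hF : 0 < F.natDegree) (hF' : ¬ SquarefullPoly F)
    (hFG : MultIndep ![F, G]) :
    ∃ A : ℝ, 0 < A ∧ ∀ p : ℕ, p.Prime → ∀ u w : (ZMod p)ˣ,
      (Nat.card {v : (ZMod p)ˣ × (ZMod p)ˣ × (ZMod p)ˣ //
        aeval (v.1 : ZMod p) F * aeval (v.2.1 : ZMod p) F * aeval (v.2.2 : ZMod p) F =
          (u : ZMod p) ∧
        aeval (v.1 : ZMod p) G * aeval (v.2.1 : ZMod p) G * aeval (v.2.2 : ZMod p) G =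
          (w : ZMod p)} : ℝ) ≤ A * (p.totient : ℝ) := by
  obtain ⟨K, N, hKN⟩ := exists_card_units_points_two_curves_le hF hF' hFG
  refine ⟨((K + N ^ 2 + 1 : ℕ) : ℝ), by positivity, fun p hp u w => ?_⟩
  have := Fact.mk hp
  rw [Nat.card_eq_fintype_card, Fintype.card_subtype]
  norm_cast
  set T := Finset.univ.filter fun v : (ZMod p)ˣ × (ZMod p)ˣ × (ZMod p)ˣ =>
    aeval (v.1 : ZMod p) F * aeval (v.2.1 : ZMod p) F * aeval (v.2.2 : ZMod p) F = (u : ZMod p) ∧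
    aeval (v.1 : ZMod p) G * aeval (v.2.1 : ZMod p) G * aeval (v.2.2 : ZMod p) G = (w : ZMod p)
  rcases le_or_gt p N with hpN | hpN
  · calc T.card ≤ p.totient * (p.totient * p.totient) := by
          refine (Finset.card_le_univ _).trans_eq ?_
          rw [Fintype.card_prod, Fintype.card_prod, ZMod.card_units_eq_totient]
      _ ≤ p.totient * (N * N) := by
          have := (Nat.totient_le p).trans hpN
          gcongr
      _ ≤ _ := by nlinarith [Nat.zero_le K, Nat.zero_le p.totient,
          Nat.zero_le (K * p.totient)]
  · calc T.card ≤ K * (T.image fun v => v.2.2).card := by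
          refine Finset.card_le_mul_card_image T K fun t ht => ?_
          obtain ⟨v₀, hv₀, rfl⟩ := Finset.mem_image.1 ht
          obtain ⟨hu, hw⟩ := (Finset.mem_filter.1 hv₀).2
          have hFt := right_ne_zero_of_mul (hu.trans_ne u.ne_zero)
          have hGt := right_ne_zero_of_mul (hw.trans_ne w.ne_zero)
          refine le_trans ?_ (hKN p hpN (u / aeval (v₀.2.2 : ZMod p) F)
            (w / aeval (v₀.2.2 : ZMod p) G) (div_ne_zero u.ne_zero hFt)
            (div_ne_zero w.ne_zero hGt))
          rw [Fintype.card_subtype]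
          refine Finset.card_le_card_of_injOn (fun v => (v.1, v.2.1)) (fun v hv => ?_) ?_
          · obtain ⟨hvT, hvt⟩ := Finset.mem_filter.1 hv
            have hvT := (Finset.mem_filter.1 hvT).2
            rw [hvt] at hvT
            simp only [Finset.coe_filter, Finset.mem_univ, true_and, Set.mem_ofPred_eq]
            exact ⟨eq_div_of_mul_eq hFt hvT.1, eq_div_of_mul_eq hGt hvT.2⟩
          · intro v hv v' hv' hvv
            have h1 := (Finset.mem_filter.1 hv).2
            have h2 := (Finset.mem_filter.1 hv').2
            simp only [Prod.mk.injEq] at hvv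
            exact Prod.ext hvv.1 (Prod.ext hvv.2 (h1.trans h2.symm))
      _ ≤ K * p.totient := by
          refine Nat.mul_le_mul_left _ ((Finset.card_le_univ _).trans_eq ?_)
          rw [ZMod.card_units_eq_totient]
      _ ≤ _ := Nat.mul_le_mul_right _ (by omega)

end PointCountSurface

theorem point_counts_on_curves_and_surfaces
    (F : Polynomial ℤ)
    (hFnc : 0 < F.natDegree)
    (hFsf : ¬ SquarefullPoly F) :
    (∃ A : ℝ, 0 < A ∧
      ∀ ℓ : ℕ, ℓ.Prime → ∀ w : (ZMod ℓ)ˣ,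
        (Nat.card {v : (ZMod ℓ)ˣ × (ZMod ℓ)ˣ //
            Polynomial.aeval ((v.1 : ZMod ℓ)) F * Polynomial.aeval ((v.2 : ZMod ℓ)) F =
              (w : ZMod ℓ)} : ℝ) ≤
          (ℓ.totient : ℝ) * (1 + A * (ℓ : ℝ) ^ (-(1 : ℝ) / 2))) ∧
    (∀ G : Polynomial ℤ, MultIndep ![F, G] →
      ∃ A' : ℝ, 0 < A' ∧
        ∀ ℓ : ℕ, ℓ.Prime → ∀ u w : (ZMod ℓ)ˣ,
          (Nat.card {v : (ZMod ℓ)ˣ × (ZMod ℓ)ˣ × (ZMod ℓ)ˣ //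
              Polynomial.aeval ((v.1 : ZMod ℓ)) F * Polynomial.aeval ((v.2.1 : ZMod ℓ)) F *
                  Polynomial.aeval ((v.2.2 : ZMod ℓ)) F = (u : ZMod ℓ) ∧
              Polynomial.aeval ((v.1 : ZMod ℓ)) G * Polynomial.aeval ((v.2.1 : ZMod ℓ)) G *
                  Polynomial.aeval ((v.2.2 : ZMod ℓ)) G = (w : ZMod ℓ)} : ℝ) ≤
            A' * (ℓ.totient : ℝ)) := by
  exact ⟨exists_card_units_points_curve_le hFnc hFsf,
    fun _ hG => exists_card_units_points_surface_le hFnc hFsf hG⟩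
end
end
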